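/- Let p̃ ∈ M̃ with t(p̃) ≤ 0, let α and β be two distinct minimal geodesic segments from p̃ to a common cut point y bounding a sector D(α, β) contained in {t < 0} which contains an end point of C_p̃. Then for any unit-speed minimal geodesic segment γ : [0, L(γ)] → M̃ joining p̃ to an end point x of C_p̃ lying in D(α, β), the point x is conjugate to p̃ along γ and L(γ) < L(α) = L(β). -/

import Mathlib

open Real Set

noncomputable section

/-- Length of a C¹ curve `c` on `[a,b]` in the warped product metric
`ds² = dt² + m(t)² dθ²` on `M̃ = ℝ²` (coordinates `(t,θ)`). -/
def wLength (m : ℝ → ℝ) (c : ℝ → ℝ × ℝ) (a b : ℝ) : ℝ :=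
  ∫ s in a..b,
    Real.sqrt ((deriv (fun u => (c u).1) s) ^ 2 +
      (m (c s).1) ^ 2 * (deriv (fun u => (c u).2) s) ^ 2)

/-- The Riemannian distance on `M̃`: the infimum of lengths of C¹ curves joining `p` to `q`. -/
def wDist (m : ℝ → ℝ) (p q : ℝ × ℝ) : ℝ :=
  sInf {L : ℝ | ∃ c : ℝ → ℝ × ℝ, ∃ b : ℝ, 0 ≤ b ∧ ContDiff ℝ 1 c ∧
    c 0 = p ∧ c b = q ∧ L = wLength m c 0 b}

/-- `γ = (t(s), θ(s))` is a unit-speed geodesic of the warped product metric: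
`t'' = m(t) m'(t) θ'²`, `m(t)² θ'` is constant, and `t'² + m(t)² θ'² = 1`. -/
def IsUnitGeodesic (m : ℝ → ℝ) (γ : ℝ → ℝ × ℝ) : Prop :=
  ContDiff ℝ 2 γ ∧
  (∀ s, deriv (deriv fun u => (γ u).1) s =
      m (γ s).1 * deriv m (γ s).1 * (deriv (fun u => (γ u).2) s) ^ 2) ∧
  (∃ ν : ℝ, ∀ s, m (γ s).1 ^ 2 * deriv (fun u => (γ u).2) s = ν) ∧
  (∀ s, (deriv (fun u => (γ u).1) s) ^ 2 +
      m (γ s).1 ^ 2 * (deriv (fun u => (γ u).2) s) ^ 2 = 1)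

/-- `ν` is the Clairaut constant of the geodesic `γ`: `m(t(s))² θ'(s) = ν` for all `s`. -/
def HasClairaut (m : ℝ → ℝ) (γ : ℝ → ℝ × ℝ) (ν : ℝ) : Prop :=
  ∀ s, m (γ s).1 ^ 2 * deriv (fun u => (γ u).2) s = ν

/-- The (unit-speed) geodesic segment `γ|[0,a]` is minimal: its length `a` equals
the distance between its endpoints. -/
def IsMinimalSeg (m : ℝ → ℝ) (γ : ℝ → ℝ × ℝ) (a : ℝ) : Prop :=
  wDist m (γ 0) (γ a) = a

/-- `x` is a cut point of `p`: the endpoint of some minimal geodesic segment from `p`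
no extension of which is minimal. -/
def IsCutPoint (m : ℝ → ℝ) (p x : ℝ × ℝ) : Prop :=
  ∃ γ : ℝ → ℝ × ℝ, ∃ a : ℝ, IsUnitGeodesic m γ ∧ γ 0 = p ∧ 0 < a ∧ γ a = x ∧
    IsMinimalSeg m γ a ∧ ∀ ε > 0, ¬ IsMinimalSeg m γ (a + ε)

/-- The cut locus of `p` in `M̃`. -/
def cutLocus (m : ℝ → ℝ) (p : ℝ × ℝ) : Set (ℝ × ℝ) := {x | IsCutPoint m p x}

/-- The Gaussian curvature `K(t) = -m''(t)/m(t)` of the warped product metric. -/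
def gaussK (m : ℝ → ℝ) (t : ℝ) : ℝ := -(deriv (deriv m) t) / m t

/-- `ξ(ν) := min {t > 0 | m t = ν}`. -/
def xi (m : ℝ → ℝ) (ν : ℝ) : ℝ := sInf {t : ℝ | 0 < t ∧ m t = ν}

/-- `φ(ν) := 2∫₀^{ξ(ν)} ν / (m(t) √(m(t)² - ν²)) dt`. -/
def phi (m : ℝ → ℝ) (ν : ℝ) : ℝ :=
  2 * ∫ t in (0:ℝ)..(xi m ν), ν / (m t * Real.sqrt ((m t) ^ 2 - ν ^ 2))

/-- `l(ν) := 2∫_{-ξ(ν)}^{0} m(t) / √(m(t)² - ν²) dt`. -/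
def ell (m : ℝ → ℝ) (ν : ℝ) : ℝ :=
  2 * ∫ t in (-(xi m ν))..(0:ℝ), m t / Real.sqrt ((m t) ^ 2 - ν ^ 2)

/-- `inf m`. -/
def infm (m : ℝ → ℝ) : ℝ := ⨅ t : ℝ, m t

/-- `t₀ := sup {t > 0 | m'(t) < 0}`. -/
def tZero (m : ℝ → ℝ) : ℝ := sSup {t : ℝ | 0 < t ∧ deriv m t < 0}

/-- `Γ_x`: the set of all points lying on some minimal geodesic segment joining `p` to `x`. -/
def SegPoints (m : ℝ → ℝ) (p x : ℝ × ℝ) : Set (ℝ × ℝ) :=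
  {z | ∃ γ : ℝ → ℝ × ℝ, ∃ a : ℝ, IsUnitGeodesic m γ ∧ γ 0 = p ∧ 0 < a ∧ γ a = x ∧
    IsMinimalSeg m γ a ∧ ∃ s ∈ Set.Icc (0:ℝ) a, γ s = z}

/-- A sector at the cut point `x` of `p`: a connected component of `M̃ \ Γ_x`. -/
def IsSector (m : ℝ → ℝ) (p x : ℝ × ℝ) (D : Set (ℝ × ℝ)) : Prop :=
  ∃ z ∈ (SegPoints m p x)ᶜ, D = connectedComponentIn (SegPoints m p x)ᶜ z

/-- `x` is an end point of the cut locus of `p`: a cut point admitting exactly one sector. -/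
def IsEndPoint (m : ℝ → ℝ) (p x : ℝ × ℝ) : Prop :=
  IsCutPoint m p x ∧ ∃! D : Set (ℝ × ℝ), IsSector m p x D

/-- `D` is a sector bounded by the two geodesic segments `α|[0,Lα]` and `β|[0,Lβ]`:
a connected component of the complement of their union. -/
def IsSectorOf (α β : ℝ → ℝ × ℝ) (Lα Lβ : ℝ) (D : Set (ℝ × ℝ)) : Prop :=
  ∃ z ∈ (α '' Set.Icc 0 Lα ∪ β '' Set.Icc 0 Lβ)ᶜ,
    D = connectedComponentIn (α '' Set.Icc 0 Lα ∪ β '' Set.Icc 0 Lβ)ᶜ z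

/-- `γ s₁` is conjugate to `γ 0` along the geodesic `γ`: there is a nontrivial solution `J`
of the Jacobi equation `J'' + K(t(s)) J = 0` with `J 0 = J s₁ = 0`. -/
def ConjugateAlong (m : ℝ → ℝ) (γ : ℝ → ℝ × ℝ) (s₁ : ℝ) : Prop :=
  ∃ J : ℝ → ℝ, ContDiff ℝ 2 J ∧
    (∀ s, deriv (deriv J) s + gaussK m (γ s).1 * J s = 0) ∧
    J 0 = 0 ∧ J s₁ = 0 ∧ J ≠ 0

open Real Set
noncomputable section

open Filter Topology MeasureTheory

lemma inv_aux (f f' : ℝ → ℝ) (hf : ∀ x, HasDerivAt f (f' x) x) (hpos : ∀ x, 0 < f' x) :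
    ∃ g : ℝ → ℝ, StrictMono f ∧ (∀ x, g (f x) = x) ∧ IsOpen (range f) ∧ OrdConnected (range f) ∧
      ∀ y ∈ range f, f (g y) = y ∧ HasDerivAt g (f' (g y))⁻¹ y := by
  have hmono : StrictMono f := strictMono_of_hasDerivAt_pos hf hpos
  have hcont : Continuous f := continuous_iff_continuousAt.2 fun x => (hf x).continuousAt
  have hoc : OrdConnected (range f) := (isPreconnected_range hcont).ordConnected
  have hemb := hmono.isEmbedding_of_ordConnected hoc
  have hopen : IsOpen (range f) := by
    rw [isOpen_iff_mem_nhds]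
    rintro _ ⟨x, rfl⟩
    have h1 : f (x-1) < f x := hmono (by linarith)
    have h2 : f x < f (x+1) := hmono (by linarith)
    exact mem_of_superset (Icc_mem_nhds h1 h2) (hoc.out (mem_range_self _) (mem_range_self _))
  have hoe : IsOpenEmbedding f := ⟨hemb, hopen⟩
  have hleft : ∀ x, Function.invFun f (f x) = x := Function.leftInverse_invFun hmono.injective
  refine ⟨Function.invFun f, hmono, hleft, hopen, hoc, ?_⟩
  rintro _ ⟨x, rfl⟩
  rw [hleft]
  refine ⟨rfl, ?_⟩
  have hc : ContinuousAt (Function.invFun f) (f x) := by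
    rw [hoe.continuousAt_iff.symm]
    have : Function.invFun f ∘ f = id := funext hleft
    rw [this]; exact continuousAt_id
  refine HasDerivAt.of_local_left_inverse hc (by rw [hleft]; exact hf x) (hpos x).ne' ?_
  filter_upwards [hopen.mem_nhds (mem_range_self x)] with y hy
  obtain ⟨z, rfl⟩ := hy
  rw [hleft]

end

open Real Set
noncomputable section

open Filter Topology MeasureTheory

/-- speed -/
def spd (m : ℝ → ℝ) (x x' y' : ℝ) : ℝ := Real.sqrt (x' ^ 2 + (m x) ^ 2 * y' ^ 2)

lemma spd_scale (m : ℝ → ℝ) (x x' y' k : ℝ) (hk : 0 ≤ k) :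
    spd m x (x' * k) (y' * k) = spd m x x' y' * k := by
  unfold spd
  rw [show (x' * k) ^ 2 + (m x) ^ 2 * (y' * k) ^ 2 = (x' ^ 2 + (m x) ^ 2 * y' ^ 2) * k ^ 2 by ring,
    Real.sqrt_mul' _ (sq_nonneg k), Real.sqrt_sq hk]

lemma wLength_nonneg (m : ℝ → ℝ) (c : ℝ → ℝ × ℝ) {a b : ℝ} (h : a ≤ b) : 0 ≤ wLength m c a b :=
  intervalIntegral.integral_nonneg h fun _ _ => Real.sqrt_nonneg _

lemma wDist_bdd (m : ℝ → ℝ) (p q : ℝ × ℝ) :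
    BddBelow {L : ℝ | ∃ c : ℝ → ℝ × ℝ, ∃ b : ℝ, 0 ≤ b ∧ ContDiff ℝ 1 c ∧
    c 0 = p ∧ c b = q ∧ L = wLength m c 0 b} :=
  ⟨0, by rintro L ⟨c, b, hb, -, -, -, rfl⟩; exact wLength_nonneg m c hb⟩

lemma wDist_le (m : ℝ → ℝ) (c : ℝ → ℝ × ℝ) (hc : ContDiff ℝ 1 c) {b : ℝ} (hb : 0 ≤ b)
    {p q : ℝ × ℝ} (h0 : c 0 = p) (h1 : c b = q) :
    wDist m p q ≤ wLength m c 0 b :=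
  csInf_le (wDist_bdd m p q) ⟨c, b, hb, hc, h0, h1, rfl⟩

lemma wDist_exists (m : ℝ → ℝ) (p q : ℝ × ℝ) {ε : ℝ} (hε : 0 < ε) :
    ∃ c : ℝ → ℝ × ℝ, ∃ b : ℝ, 0 ≤ b ∧ ContDiff ℝ 1 c ∧ c 0 = p ∧ c b = q ∧
      wLength m c 0 b < wDist m p q + ε := by
  have hne : {L : ℝ | ∃ c : ℝ → ℝ × ℝ, ∃ b : ℝ, 0 ≤ b ∧ ContDiff ℝ 1 c ∧
    c 0 = p ∧ c b = q ∧ L = wLength m c 0 b}.Nonempty := by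
    refine ⟨_, fun s => p + s • (q - p), 1, zero_le_one, by fun_prop, by simp, by simp, rfl⟩
  obtain ⟨L, ⟨c, b, hb, hc, h0, h1, rfl⟩, hL⟩ := exists_lt_of_csInf_lt hne
    (show wDist m p q < wDist m p q + ε by linarith)
  exact ⟨c, b, hb, hc, h0, h1, hL⟩


lemma S_hasDeriv (x : ℝ) : HasDerivAt Real.smoothTransition (deriv Real.smoothTransition x) x :=
  ((Real.smoothTransition.contDiff (n := 1)).differentiable (by norm_num) x).hasDerivAt

lemma S_cont_deriv : Continuous (deriv Real.smoothTransition) :=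
  (Real.smoothTransition.contDiff (n := 1)).continuous_deriv le_rfl

lemma S_deriv_nonneg (x : ℝ) : 0 ≤ deriv Real.smoothTransition x := Real.smoothTransition.monotone.deriv_nonneg

lemma S_deriv_zero {x : ℝ} (hx : x ≤ 0) : deriv Real.smoothTransition x = 0 := by
  apply IsLocalMin.deriv_eq_zero
  refine Eventually.of_forall fun y => ?_
  simp only [Real.smoothTransition.zero_of_nonpos hx]
  exact Real.smoothTransition.nonneg y

lemma S_deriv_one {x : ℝ} (hx : 1 ≤ x) : deriv Real.smoothTransition x = 0 := by
  apply IsLocalMax.deriv_eq_zero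
  refine Eventually.of_forall fun y => ?_
  simp only [Real.smoothTransition.one_of_one_le hx]
  exact Real.smoothTransition.le_one y

/-- Length bound for curves `C¹` on a neighbourhood of `[a,b]`. -/
lemma wDist_le_param (m : ℝ → ℝ) (hm : Continuous m) (x y x' y' : ℝ → ℝ) (I : Set ℝ)
    (hI : IsOpen I) {a b : ℝ} (hab : a ≤ b) (hsub : Icc a b ⊆ I)
    (hx : ∀ s ∈ I, HasDerivAt x (x' s) s) (hy : ∀ s ∈ I, HasDerivAt y (y' s) s)
    (hx' : ContinuousOn x' I) (hy' : ContinuousOn y' I) :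
    wDist m (x a, y a) (x b, y b) ≤ ∫ s in a..b, spd m (x s) (x' s) (y' s) := by
  set r : ℝ → ℝ := fun s => a + (b - a) * Real.smoothTransition s with hr
  have hrd : ∀ s, HasDerivAt r ((b - a) * deriv Real.smoothTransition s) s := fun s =>
    ((S_hasDeriv s).const_mul (b - a)).const_add a
  have hrC : ContDiff ℝ 1 r := by
    have := (Real.smoothTransition.contDiff (n := 1))
    fun_prop
  have hrm : ∀ s, r s ∈ Icc a b := fun s => by
    have h1 := Real.smoothTransition.nonneg s
    have h2 := Real.smoothTransition.le_one s
    constructor <;> simp only [hr] <;> nlinarith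
  have hrI : ∀ s, r s ∈ I := fun s => hsub (hrm s)
  have hC1 : ∀ z z' : ℝ → ℝ, (∀ s ∈ I, HasDerivAt z (z' s) s) → ContinuousOn z' I →
      ContDiff ℝ 1 (fun s => z (r s)) := by
    intro z z' hz hz'
    have hcz : ContDiffOn ℝ 1 z I := by
      have : (1 : WithTop ℕ∞) = 0 + 1 := by norm_num
      rw [this, contDiffOn_succ_iff_deriv_of_isOpen hI]
      refine ⟨fun s hs => (hz s hs).differentiableAt.differentiableWithinAt, by simp, ?_⟩
      rw [contDiffOn_zero]
      exact hz'.congr fun s hs => (hz s hs).deriv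
    rw [← contDiffOn_univ]
    exact hcz.comp hrC.contDiffOn (fun s _ => hrI s)
  have hc : ContDiff ℝ 1 (fun s => (x (r s), y (r s))) := (hC1 x x' hx hx').prodMk (hC1 y y' hy hy')
  have hr0 : r 0 = a := by simp [hr]
  have hr1 : r 1 = b := by simp [hr]
  refine (wDist_le m _ hc zero_le_one (by simp [hr0]) (by simp [hr1])).trans (le_of_eq ?_)
  have key : ∀ s, Real.sqrt ((deriv (fun u => x (r u)) s) ^ 2 +
      (m (x (r s))) ^ 2 * (deriv (fun u => y (r u)) s) ^ 2) =
      ((fun s => spd m (x s) (x' s) (y' s)) ∘ r) s * ((b - a) * deriv Real.smoothTransition s) := by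
    intro s
    have h1 : HasDerivAt (fun u => x (r u)) _ s := (hx _ (hrI s)).comp s (hrd s)
    have h2 : HasDerivAt (fun u => y (r u)) _ s := (hy _ (hrI s)).comp s (hrd s)
    rw [h1.deriv, h2.deriv]
    exact spd_scale m _ _ _ _ (mul_nonneg (by linarith) (S_deriv_nonneg s))
  unfold wLength
  simp only [key]
  rw [intervalIntegral.integral_comp_mul_deriv' (fun s _ => hrd s), hr0, hr1]
  · exact (continuous_const.mul S_cont_deriv).continuousOn
  · have hxc : ContinuousOn x I := fun s hs => (hx s hs).continuousAt.continuousWithinAt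
    have : ContinuousOn (fun s => spd m (x s) (x' s) (y' s)) I := by
      unfold spd
      have := hm.comp_continuousOn hxc
      exact ((hx'.pow 2).add ((this.pow 2).mul (hy'.pow 2))).sqrt
    refine this.mono ?_
    rintro _ ⟨s, -, rfl⟩
    exact hrI s

lemma wDist_triangle (m : ℝ → ℝ) (hm : Continuous m) (p q r : ℝ × ℝ) :
    wDist m p r ≤ wDist m p q + wDist m q r := by
  refine le_of_forall_pos_le_add fun ε hε => ?_
  obtain ⟨c, b, hb, hc, h0, h1, hL⟩ := wDist_exists m p q (half_pos hε)
  obtain ⟨d, e, he, hd, k0, k1, kL⟩ := wDist_exists m q r (half_pos hε)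
  set f : ℝ → ℝ := fun s => b * Real.smoothTransition s with hf
  set g : ℝ → ℝ := fun s => e * Real.smoothTransition (s - 1) with hg
  have hfd : ∀ s, HasDerivAt f (b * deriv Real.smoothTransition s) s := fun s => (S_hasDeriv s).const_mul b
  have hgd : ∀ s, HasDerivAt g (e * deriv Real.smoothTransition (s - 1)) s := fun s => by
    have := ((S_hasDeriv (s - 1)).comp_sub_const s 1).const_mul e
    exact this
  have hfC : ContDiff ℝ 1 f := by
    have := (Real.smoothTransition.contDiff (n := 1))
    fun_prop
  have hgC : ContDiff ℝ 1 g := by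
    have := (Real.smoothTransition.contDiff (n := 1))
    fun_prop
  have hC : ContDiff ℝ 1 (fun s => c (f s) + d (g s) - q) :=
    ((hc.comp hfC).add (hd.comp hgC)).sub contDiff_const
  have hcd1 : ∀ s, HasDerivAt (fun u => (c u).1) (deriv (fun u => (c u).1) s) s := fun s =>
    ((contDiff_fst.comp hc).differentiable (by norm_num) s).hasDerivAt
  have hcd2 : ∀ s, HasDerivAt (fun u => (c u).2) (deriv (fun u => (c u).2) s) s := fun s =>
    ((contDiff_snd.comp hc).differentiable (by norm_num) s).hasDerivAt
  have hdd1 : ∀ s, HasDerivAt (fun u => (d u).1) (deriv (fun u => (d u).1) s) s := fun s =>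
    ((contDiff_fst.comp hd).differentiable (by norm_num) s).hasDerivAt
  have hdd2 : ∀ s, HasDerivAt (fun u => (d u).2) (deriv (fun u => (d u).2) s) s := fun s =>
    ((contDiff_snd.comp hd).differentiable (by norm_num) s).hasDerivAt
  have hspc : ∀ c : ℝ → ℝ × ℝ, ContDiff ℝ 1 c → Continuous (fun s => spd m (c s).1
      (deriv (fun u => (c u).1) s) (deriv (fun u => (c u).2) s)) := by
    intro c hc
    have e1 : Continuous (deriv (fun u => (c u).1)) :=
      (contDiff_fst.comp hc).continuous_deriv le_rfl
    have e2 : Continuous (deriv (fun u => (c u).2)) :=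
      (contDiff_snd.comp hc).continuous_deriv le_rfl
    have e3 := hc.continuous
    unfold spd
    fun_prop
  have D1 : ∀ s, deriv (fun u => (c (f u) + d (g u) - q).1) s =
      deriv (fun u => (c u).1) (f s) * (b * deriv Real.smoothTransition s) +
      deriv (fun u => (d u).1) (g s) * (e * deriv Real.smoothTransition (s - 1)) := fun s => by
    have h1 := (hcd1 (f s)).comp s (hfd s)
    have h2 := (hdd1 (g s)).comp s (hgd s)
    exact ((h1.add h2).sub_const q.1).deriv
  have D2 : ∀ s, deriv (fun u => (c (f u) + d (g u) - q).2) s =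
      deriv (fun u => (c u).2) (f s) * (b * deriv Real.smoothTransition s) +
      deriv (fun u => (d u).2) (g s) * (e * deriv Real.smoothTransition (s - 1)) := fun s => by
    have h1 := (hcd2 (f s)).comp s (hfd s)
    have h2 := (hdd2 (g s)).comp s (hgd s)
    exact ((h1.add h2).sub_const q.2).deriv
  have f0 : f 0 = 0 := by simp [hf]
  have f1 : ∀ s, 1 ≤ s → f s = b := fun s hs => by simp [hf, Real.smoothTransition.one_of_one_le hs]
  have g0 : ∀ s, s ≤ 1 → g s = 0 := fun s hs => by
    simp [hg, Real.smoothTransition.zero_of_nonpos (show s - 1 ≤ 0 by linarith)]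
  have g2 : g 2 = e := by
    simp [hg, Real.smoothTransition.one_of_one_le (show (1:ℝ) ≤ 2 - 1 by norm_num)]
  have hle := wDist_le m _ hC (show (0:ℝ) ≤ 2 by norm_num) (p := p) (q := r)
    (by simp [f0, g0 0 (by norm_num), h0, k0]) (by simp [f1 2 (by norm_num), g2, h1, k1])
  have hsplit : wLength m (fun s => c (f s) + d (g s) - q) 0 2 =
      wLength m c 0 b + wLength m d 0 e := by
    have hintg := fun a b => (hspc _ hC).intervalIntegrable (μ := volume) a b
    have hs := intervalIntegral.integral_add_adjacent_intervals (hintg 0 1) (hintg 1 2)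
    change (∫ s in (0:ℝ)..2, spd m _ _ _) = _
    rw [← hs]
    congr 1
    · have : ∀ s ∈ uIcc (0:ℝ) 1, spd m (c (f s) + d (g s) - q).1
          (deriv (fun u => (c (f u) + d (g u) - q).1) s)
          (deriv (fun u => (c (f u) + d (g u) - q).2) s) =
          ((fun s => spd m (c s).1 (deriv (fun u => (c u).1) s) (deriv (fun u => (c u).2) s)) ∘ f) s
            * (b * deriv Real.smoothTransition s) := by
        intro s hs
        rw [uIcc_of_le zero_le_one] at hs
        rw [D1, D2, S_deriv_zero (show s - 1 ≤ 0 by linarith [hs.2]), g0 s hs.2, k0]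
        simp only [mul_zero, add_zero, add_sub_cancel_right]
        exact spd_scale m _ _ _ _ (mul_nonneg hb (S_deriv_nonneg s))
      rw [intervalIntegral.integral_congr this, intervalIntegral.integral_comp_mul_deriv
        (fun s _ => hfd s) (continuous_const.mul S_cont_deriv).continuousOn (hspc c hc),
        f0, f1 1 le_rfl]
      rfl
    · have : ∀ s ∈ uIcc (1:ℝ) 2, spd m (c (f s) + d (g s) - q).1
          (deriv (fun u => (c (f u) + d (g u) - q).1) s)
          (deriv (fun u => (c (f u) + d (g u) - q).2) s) =
          ((fun s => spd m (d s).1 (deriv (fun u => (d u).1) s) (deriv (fun u => (d u).2) s)) ∘ g) s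
            * (e * deriv Real.smoothTransition (s - 1)) := by
        intro s hs
        rw [uIcc_of_le (by norm_num)] at hs
        rw [D1, D2, S_deriv_one hs.1, f1 s hs.1, h1]
        simp only [mul_zero, zero_add, add_sub_cancel_left]
        exact spd_scale m _ _ _ _ (mul_nonneg he (S_deriv_nonneg _))
      rw [intervalIntegral.integral_congr this, intervalIntegral.integral_comp_mul_deriv
        (fun s _ => hgd s) (continuous_const.mul
          (S_cont_deriv.comp (continuous_id.sub continuous_const))).continuousOn (hspc d hd),
        g0 1 le_rfl, g2]
      rfl
  rw [hsplit] at hle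
  linarith

end

open Real Set
noncomputable section

open Filter Topology MeasureTheory
open scoped Interval

/-- The coordinate change `u = ∫ dt / m²` and its inverse `T`. -/
structure WData (m U T : ℝ → ℝ) (J : Set ℝ) : Prop where
  mcont : Continuous m
  mpos : ∀ t, 0 < m t
  mder : ∀ t, HasDerivAt m (deriv m t) t
  mdcont : Continuous (deriv m)
  Jopen : IsOpen J
  Jord : OrdConnected J
  UJ : ∀ t, U t ∈ J
  TU : ∀ t, T (U t) = t
  UT : ∀ u ∈ J, U (T u) = u
  Umono : StrictMono U
  Uder : ∀ t, HasDerivAt U ((m t ^ 2)⁻¹) t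
  Tder : ∀ u ∈ J, HasDerivAt T (m (T u) ^ 2) u

def FR (M v : ℝ) : ℝ := √(1 + M ^ 2 * v ^ 2)
def FL (m T : ℝ → ℝ) (u v : ℝ) : ℝ := m (T u) * FR (m (T u)) v
def Fv (m T : ℝ → ℝ) (u v : ℝ) : ℝ := m (T u) ^ 3 * v / FR (m (T u)) v
def Fu (m T : ℝ → ℝ) (u v : ℝ) : ℝ :=
  deriv m (T u) * m (T u) ^ 2 * (1 + 2 * (m (T u) ^ 2 * v ^ 2)) / FR (m (T u)) v
def Fvv (m T : ℝ → ℝ) (u v : ℝ) : ℝ := m (T u) ^ 3 / FR (m (T u)) v ^ 3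
def Fuv (m T : ℝ → ℝ) (u v : ℝ) : ℝ :=
  m (T u) ^ 2 * (deriv m (T u) * m (T u) ^ 2) * v * (3 + 2 * (m (T u) ^ 2 * v ^ 2)) /
    FR (m (T u)) v ^ 3
def GG (m T : ℝ → ℝ) (u : ℝ) : ℝ := deriv m (T u) / m (T u)

lemma FR_pos (M v : ℝ) : 0 < FR M v := Real.sqrt_pos.2 (by positivity)
lemma FR_sq (M v : ℝ) : FR M v ^ 2 = 1 + M ^ 2 * v ^ 2 := Real.sq_sqrt (by positivity)

variable {m U T : ℝ → ℝ} {J : Set ℝ}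

lemma Fvv_pos (h : WData m U T J) (u v : ℝ) : 0 < Fvv m T u v := by
  have := h.mpos (T u)
  have := FR_pos (m (T u)) v
  unfold Fvv; positivity

lemma EL_identity (h : WData m U T J) (u v : ℝ) :
    Fu m T u v - Fuv m T u v * v = Fvv m T u v * GG m T u := by
  have h1 := (h.mpos (T u)).ne'
  have h2 := (FR_pos (m (T u)) v).ne'
  have h3 := FR_sq (m (T u)) v
  unfold Fu Fuv Fvv GG
  generalize FR (m (T u)) v = R at *
  generalize m (T u) = M at *
  generalize deriv m (T u) = M' at *
  field_simp
  linear_combination (M' * (1 + 2 * M^2 * v^2)) * h3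

lemma FL_eq_spd (h : WData m U T J) (u v : ℝ) :
    spd m (T u) (m (T u) ^ 2 * v) 1 = FL m T u v := by
  have h1 := (h.mpos (T u))
  unfold spd FL FR
  rw [show (m (T u) ^ 2 * v) ^ 2 + m (T u) ^ 2 * 1 ^ 2 = m (T u) ^ 2 * (1 + m (T u) ^ 2 * v ^ 2) by ring,
    Real.sqrt_mul (sq_nonneg _), Real.sqrt_sq h1.le]

lemma Mder (h : WData m U T J) {a b : ℝ → ℝ} {a' x : ℝ} (ha : HasDerivAt a a' x)
    (hJ : a x ∈ J) : HasDerivAt (fun s => m (T (a s))) (deriv m (T (a x)) * m (T (a x)) ^ 2 * a') x := by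
  have h1 := (h.Tder _ hJ).comp x ha
  have h2 := (h.mder (T (a x))).comp x h1
  exact h2.congr_deriv (by ring)

lemma Rder (h : WData m U T J) {a b : ℝ → ℝ} {a' b' x : ℝ} (ha : HasDerivAt a a' x)
    (hb : HasDerivAt b b' x) (hJ : a x ∈ J) :
    HasDerivAt (fun s => FR (m (T (a s))) (b s))
      ((m (T (a x)) * (deriv m (T (a x)) * m (T (a x)) ^ 2 * a') * b x ^ 2 + m (T (a x)) ^ 2 * b x * b')
        / FR (m (T (a x))) (b x)) x := by
  have h1 := Mder (b := b) h ha hJ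
  have h2 : HasDerivAt (fun s => 1 + m (T (a s)) ^ 2 * b s ^ 2) _ x :=
    ((h1.pow 2).mul (hb.pow 2)).const_add 1
  have h3 := h2.sqrt (by positivity)
  refine h3.congr_deriv ?_
  have h2 := (FR_pos (m (T (a x))) (b x)).ne'
  change _ / (2 * FR (m (T (a x))) (b x)) = _
  simp only [Nat.cast_ofNat, Pi.pow_apply]
  field_simp
  ring

lemma FLder (h : WData m U T J) {a b : ℝ → ℝ} {a' b' x : ℝ} (ha : HasDerivAt a a' x)
    (hb : HasDerivAt b b' x) (hJ : a x ∈ J) :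
    HasDerivAt (fun s => FL m T (a s) (b s)) (Fu m T (a x) (b x) * a' + Fv m T (a x) (b x) * b') x := by
  have h1 := (Mder (b := b) h ha hJ).mul (Rder h ha hb hJ)
  refine h1.congr_deriv ?_
  unfold Fu Fv
  have h2 := (FR_pos (m (T (a x))) (b x)).ne'
  have h3 := FR_sq (m (T (a x))) (b x)
  generalize FR (m (T (a x))) (b x) = R at *
  generalize m (T (a x)) = M at *
  generalize deriv m (T (a x)) = M' at *
  field_simp
  linear_combination (M ^ 2 * M' * a') * h3

lemma Fvder (h : WData m U T J) {a b : ℝ → ℝ} {a' b' x : ℝ} (ha : HasDerivAt a a' x)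
    (hb : HasDerivAt b b' x) (hJ : a x ∈ J) :
    HasDerivAt (fun s => Fv m T (a s) (b s))
      (Fuv m T (a x) (b x) * a' + Fvv m T (a x) (b x) * b') x := by
  have h2 := (FR_pos (m (T (a x))) (b x)).ne'
  have h1 := (((Mder (b := b) h ha hJ).pow 3).mul hb).div (Rder h ha hb hJ) h2
  refine h1.congr_deriv ?_
  unfold Fuv Fvv
  have h3 := FR_sq (m (T (a x))) (b x)
  simp only [Pi.pow_apply, Pi.mul_apply, Nat.cast_ofNat]
  generalize FR (m (T (a x))) (b x) = R at *
  generalize m (T (a x)) = M at *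
  generalize deriv m (T (a x)) = M' at *
  generalize b x = v at *
  have h4 : R^2 = 1 + M^2*v^2 := h3
  field_simp
  norm_num
  linear_combination (3 * M^4 * M' * v * a' + M^2*b' * M) * h4

lemma Tcont (h : WData m U T J) : ContinuousOn T J :=
  fun u hu => (h.Tder u hu).continuousAt.continuousWithinAt

lemma cont_comp (h : WData m U T J) {X : Type*} [TopologicalSpace X] {s : Set X} {a b : X → ℝ}
    (ha : ContinuousOn a s) (hb : ContinuousOn b s) (hJ : ∀ x ∈ s, a x ∈ J) :
    ContinuousOn (fun x => FL m T (a x) (b x)) s ∧ ContinuousOn (fun x => Fu m T (a x) (b x)) s ∧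
    ContinuousOn (fun x => Fv m T (a x) (b x)) s ∧ ContinuousOn (fun x => Fvv m T (a x) (b x)) s ∧
    ContinuousOn (fun x => Fuv m T (a x) (b x)) s ∧ ContinuousOn (fun x => GG m T (a x)) s := by
  have hT : ContinuousOn (fun x => T (a x)) s := (Tcont h).comp ha hJ
  have hM : ContinuousOn (fun x => m (T (a x))) s := h.mcont.comp_continuousOn hT
  have hM' : ContinuousOn (fun x => deriv m (T (a x))) s := h.mdcont.comp_continuousOn hT
  have hR : ContinuousOn (fun x => FR (m (T (a x))) (b x)) s :=
    (continuousOn_const.add ((hM.pow 2).mul (hb.pow 2))).sqrt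
  have hR0 : ∀ x ∈ s, FR (m (T (a x))) (b x) ≠ 0 := fun x _ => (FR_pos _ _).ne'
  have hR3 : ∀ x ∈ s, FR (m (T (a x))) (b x) ^ 3 ≠ 0 := fun x hx => pow_ne_zero _ (hR0 x hx)
  have hM0 : ∀ x ∈ s, m (T (a x)) ≠ 0 := fun x _ => (h.mpos _).ne'
  have hq := continuousOn_const (c := (2:ℝ)).mul ((hM.pow 2).mul (hb.pow 2))
  exact ⟨hM.mul hR, ((hM'.mul (hM.pow 2)).mul (continuousOn_const.add hq)).div hR hR0,
    ((hM.pow 3).mul hb).div hR hR0, (hM.pow 3).div (hR.pow 3) hR3,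
    ((((hM.pow 2).mul (hM'.mul (hM.pow 2))).mul hb).mul (continuousOn_const.add hq)).div
      (hR.pow 3) hR3, hM'.div hM hM0⟩

/-- First variation formula. -/
lemma first_variation (h : WData m U T J) {u v w e e1 e2 : ℝ → ℝ} {I : Set ℝ} {a b : ℝ}
    (hab : a ≤ b) (hsub : Icc a b ⊆ I)
    (hu : ∀ s ∈ I, HasDerivAt u (v s) s) (hv : ∀ s ∈ I, HasDerivAt v (w s) s)
    (hw : ContinuousOn w I)
    (he : ∀ s ∈ I, HasDerivAt e (e1 s) s) (he1 : ∀ s ∈ I, HasDerivAt e1 (e2 s) s)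
    {δ : ℝ} (hδ : 0 < δ) (hJ : ∀ l, |l| < δ → ∀ s ∈ Icc a b, u s + l * e s ∈ J) :
    HasDerivAt (fun l => ∫ s in a..b, FL m T (u s + l * e s) (v s + l * e1 s))
      (Fv m T (u b) (v b) * e b - Fv m T (u a) (v a) * e a +
        ∫ s in a..b, Fvv m T (u s) (v s) * (GG m T (u s) - w s) * e s) 0 := by
  have cu : ContinuousOn u (Icc a b) := fun s hs => (hu s (hsub hs)).continuousAt.continuousWithinAt
  have cv : ContinuousOn v (Icc a b) := fun s hs => (hv s (hsub hs)).continuousAt.continuousWithinAt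
  have ce : ContinuousOn e (Icc a b) := fun s hs => (he s (hsub hs)).continuousAt.continuousWithinAt
  have ce1 : ContinuousOn e1 (Icc a b) :=
    fun s hs => (he1 s (hsub hs)).continuousAt.continuousWithinAt
  have cw : ContinuousOn w (Icc a b) := hw.mono hsub
  have huJ : ∀ s ∈ Icc a b, u s ∈ J := fun s hs => by simpa using hJ 0 (by simpa using hδ) s hs
  set K : Set (ℝ × ℝ) := Icc (-(δ/2)) (δ/2) ×ˢ Icc a b with hK
  have hKc : IsCompact K := isCompact_Icc.prod isCompact_Icc
  have hlt : ∀ l ∈ Icc (-(δ/2)) (δ/2), |l| < δ := fun l hl => by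
    rw [abs_lt]; constructor <;> linarith [hl.1, hl.2]
  have snd_maps : MapsTo Prod.snd K (Icc a b) := fun z hz => hz.2
  have c1 : ContinuousOn (fun z : ℝ × ℝ => u z.2 + z.1 * e z.2) K :=
    (cu.comp continuousOn_snd snd_maps).add
      (continuousOn_fst.mul (ce.comp continuousOn_snd snd_maps))
  have c2 : ContinuousOn (fun z : ℝ × ℝ => v z.2 + z.1 * e1 z.2) K :=
    (cv.comp continuousOn_snd snd_maps).add
      (continuousOn_fst.mul (ce1.comp continuousOn_snd snd_maps))
  have hKJ : ∀ z ∈ K, u z.2 + z.1 * e z.2 ∈ J := fun z hz => hJ _ (hlt _ hz.1) _ hz.2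
  obtain ⟨cFL, cFu, cFv, -, -, -⟩ := cont_comp h c1 c2 hKJ
  obtain ⟨dFL, dFu, dFv, dFvv, dFuv, dG⟩ := cont_comp h cu cv huJ
  set F' : ℝ → ℝ → ℝ := fun l s => Fu m T (u s + l * e s) (v s + l * e1 s) * e s +
    Fv m T (u s + l * e s) (v s + l * e1 s) * e1 s with hF'
  have cF' : ContinuousOn (fun z : ℝ × ℝ => F' z.1 z.2) K :=
    (cFu.mul (ce.comp continuousOn_snd snd_maps)).add
      (cFv.mul (ce1.comp continuousOn_snd snd_maps))
  obtain ⟨C, hC⟩ := hKc.exists_bound_of_continuousOn cF'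
  have hIoc : Ι a b ⊆ Icc a b := by rw [uIoc_of_le hab]; exact Ioc_subset_Icc_self
  have hnhds : Icc (-(δ/2)) (δ/2) ∈ 𝓝 (0:ℝ) := Icc_mem_nhds (by linarith) (by linarith)
  have slice : ∀ l ∈ Icc (-(δ/2)) (δ/2), ContinuousOn (fun s => (l, s)) (Icc a b) ∧
      MapsTo (fun s => (l, s)) (Icc a b) K := fun l hl =>
    ⟨by fun_prop, fun s hs => ⟨hl, hs⟩⟩
  have h0m : (0:ℝ) ∈ Icc (-(δ/2)) (δ/2) := ⟨by linarith, by linarith⟩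
  have main := intervalIntegral.hasDerivAt_integral_of_dominated_loc_of_deriv_le
    (F := fun l s => FL m T (u s + l * e s) (v s + l * e1 s)) (F' := F') (x₀ := (0:ℝ))
    (a := a) (b := b) (μ := volume) (bound := fun _ => C) hnhds
    (by
      filter_upwards [hnhds] with l hl
      have := cFL.comp (slice l hl).1 (slice l hl).2
      exact (this.mono hIoc).aestronglyMeasurable measurableSet_uIoc)
    (by
      have := cFL.comp (slice 0 h0m).1 (slice 0 h0m).2
      rw [← uIcc_of_le hab] at this
      exact this.intervalIntegrable)
    (by
      have := cF'.comp (slice 0 h0m).1 (slice 0 h0m).2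
      exact (this.mono hIoc).aestronglyMeasurable measurableSet_uIoc)
    (Eventually.of_forall fun s hs l hl => hC (l, s) ⟨hl, hIoc hs⟩)
    (by simp)
    (Eventually.of_forall fun s hs l hl => by
      have e1' : HasDerivAt (fun l => u s + l * e s) (e s) l := by
        simpa using ((hasDerivAt_id l).mul_const (e s)).const_add (u s)
      have e2' : HasDerivAt (fun l => v s + l * e1 s) (e1 s) l := by
        simpa using ((hasDerivAt_id l).mul_const (e1 s)).const_add (v s)
      exact FLder h e1' e2' (hKJ (l, s) ⟨hl, hIoc hs⟩))
  refine main.2.congr_deriv ?_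
  have hF0 : ∀ s, F' 0 s = Fu m T (u s) (v s) * e s + Fv m T (u s) (v s) * e1 s := fun s => by
    simp [hF']
  simp only [hF0]
  have ui : uIcc a b = Icc a b := uIcc_of_le hab
  have i1 : IntervalIntegrable (fun s => Fu m T (u s) (v s) * e s) volume a b :=
    ContinuousOn.intervalIntegrable (by rw [ui]; exact dFu.mul ce)
  have i2 : IntervalIntegrable (fun s => Fv m T (u s) (v s) * e1 s) volume a b :=
    ContinuousOn.intervalIntegrable (by rw [ui]; exact dFv.mul ce1)
  have cd : ContinuousOn (fun s => Fuv m T (u s) (v s) * v s + Fvv m T (u s) (v s) * w s) (Icc a b) :=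
    (dFuv.mul cv).add (dFvv.mul cw)
  have i3 : IntervalIntegrable (fun s => (Fuv m T (u s) (v s) * v s + Fvv m T (u s) (v s) * w s) * e s)
    volume a b := ContinuousOn.intervalIntegrable (by rw [ui]; exact cd.mul ce)
  rw [intervalIntegral.integral_add i1 i2, intervalIntegral.integral_mul_deriv_eq_deriv_mul
    (u := fun s => Fv m T (u s) (v s)) (v := e)
    (u' := fun s => Fuv m T (u s) (v s) * v s + Fvv m T (u s) (v s) * w s)
    (fun s hs => Fvder h (hu s (hsub (ui ▸ hs))) (hv s (hsub (ui ▸ hs))) (huJ s (ui ▸ hs)))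
    (fun s hs => he s (hsub (ui ▸ hs)))
    (ContinuousOn.intervalIntegrable (by rw [ui]; exact cd))
    (ContinuousOn.intervalIntegrable (by rw [ui]; exact ce1))]
  have : ∀ s, Fvv m T (u s) (v s) * (GG m T (u s) - w s) * e s = Fu m T (u s) (v s) * e s -
      (Fuv m T (u s) (v s) * v s + Fvv m T (u s) (v s) * w s) * e s := fun s => by
    have := EL_identity h (u s) (v s)
    linear_combination (-e s) * this
  simp only [this]
  rw [intervalIntegral.integral_sub i1 i3]
  ring

end

open Real Set
noncomputable section

open Filter Topology MeasureTheory
open scoped Interval NNReal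

variable {m U T : ℝ → ℝ} {J : Set ℝ}

/-- Solutions of the (projective) geodesic equation `u'' = G(u)`. -/
def Sol (m T : ℝ → ℝ) (J : Set ℝ) (u v : ℝ → ℝ) (I : Set ℝ) : Prop :=
  ∀ s ∈ I, u s ∈ J ∧ HasDerivAt u (v s) s ∧ HasDerivAt v (GG m T (u s)) s

def Gr (T u : ℝ → ℝ) (s : ℝ) : ℝ × ℝ := (T (u s), s)

def Len (m T u v : ℝ → ℝ) (a b : ℝ) : ℝ := ∫ s in a..b, FL m T (u s) (v s)

lemma sol_unique (h : WData m U T J) {g : ℝ → ℝ} (hG : ∀ u ∈ J, HasDerivAt (GG m T) (g u) u)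
    (hg : ContinuousOn g J) {u1 v1 u2 v2 : ℝ → ℝ} {I : Set ℝ} (hI : OrdConnected I)
    (h1 : Sol m T J u1 v1 I) (h2 : Sol m T J u2 v2 I) {z : ℝ} (hz : z ∈ I)
    (hu : u1 z = u2 z) (hv : v1 z = v2 z) {s : ℝ} (hs : s ∈ I) :
    u1 s = u2 s ∧ v1 s = v2 s := by
  set c := min z s
  set d := max z s
  have hcd : c ≤ d := min_le_max
  have hsub : Icc c d ⊆ I := by
    have := hI.uIcc_subset hz hs
    exact this
  have cu : ∀ (u v : ℝ → ℝ), Sol m T J u v I → ContinuousOn u (Icc c d) := fun u v hh s hs =>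
    (hh s (hsub hs)).2.1.continuousAt.continuousWithinAt
  have cv : ∀ (u v : ℝ → ℝ), Sol m T J u v I → ContinuousOn v (Icc c d) := fun u v hh s hs =>
    (hh s (hsub hs)).2.2.continuousAt.continuousWithinAt
  set K : Set ℝ := u1 '' Icc c d ∪ u2 '' Icc c d with hKdef
  have hK : IsCompact K := (isCompact_Icc.image_of_continuousOn (cu _ _ h1)).union
    (isCompact_Icc.image_of_continuousOn (cu _ _ h2))
  have hKne : K.Nonempty := ⟨u1 c, Or.inl ⟨c, ⟨le_rfl, hcd⟩, rfl⟩⟩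
  have hKJ : K ⊆ J := by
    rintro _ (⟨s, hs, rfl⟩ | ⟨s, hs, rfl⟩)
    · exact (h1 s (hsub hs)).1
    · exact (h2 s (hsub hs)).1
  obtain ⟨lo, hlo⟩ := hK.exists_isLeast hKne
  obtain ⟨hi, hhi⟩ := hK.exists_isGreatest hKne
  have hIJ : Icc lo hi ⊆ J := h.Jord.out (hKJ hlo.1) (hKJ hhi.1)
  obtain ⟨C, hC⟩ := isCompact_Icc.exists_bound_of_continuousOn (hg.mono hIJ)
  have hLip : LipschitzOnWith (Real.toNNReal C) (GG m T) (Icc lo hi) := by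
    refine (convex_Icc lo hi).lipschitzOnWith_of_nnnorm_deriv_le
      (fun x hx => (hG x (hIJ hx)).differentiableAt) fun x hx => ?_
    rw [(hG x (hIJ hx)).deriv, ← NNReal.coe_le_coe]
    exact (hC x hx).trans (Real.le_coe_toNNReal C)
  have hLV : LipschitzOnWith (max 1 (Real.toNNReal C)) (fun x : ℝ × ℝ => (x.2, GG m T x.1))
      (Icc lo hi ×ˢ univ) := by
    refine LipschitzOnWith.prodMk (LipschitzWith.prod_snd.lipschitzOnWith) ?_
    have := hLip.comp (LipschitzWith.prod_fst.lipschitzOnWith (s := (Icc lo hi ×ˢ (univ : Set ℝ))))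
      (fun x hx => hx.1)
    rw [mul_one] at this
    exact this
  have hd : ∀ (u v : ℝ → ℝ), Sol m T J u v I → ∀ s ∈ Icc c d,
      HasDerivAt (fun s => (u s, v s)) (v s, GG m T (u s)) s := fun u v hh s hs =>
    (hh s (hsub hs)).2.1.prodMk (hh s (hsub hs)).2.2
  have m1 : ∀ s ∈ Icc c d, (u1 s, v1 s) ∈ Icc lo hi ×ˢ (univ : Set ℝ) := fun s hs =>
    ⟨⟨hlo.2 (Or.inl ⟨s, hs, rfl⟩), hhi.2 (Or.inl ⟨s, hs, rfl⟩)⟩, trivial⟩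
  have m2 : ∀ s ∈ Icc c d, (u2 s, v2 s) ∈ Icc lo hi ×ˢ (univ : Set ℝ) := fun s hs =>
    ⟨⟨hlo.2 (Or.inr ⟨s, hs, rfl⟩), hhi.2 (Or.inr ⟨s, hs, rfl⟩)⟩, trivial⟩
  have hEq : EqOn (fun s => (u1 s, v1 s)) (fun s => (u2 s, v2 s)) (Icc c d) := by
    rcases le_total z s with hzs | hzs
    · have hc : c = z := min_eq_left hzs
      refine ODE_solution_unique_of_mem_Icc_right (v := fun _ x => (x.2, GG m T x.1))
        (s := fun _ => Icc lo hi ×ˢ univ) (fun _ _ => hLV)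
        ((cu _ _ h1).prodMk (cv _ _ h1))
        (fun s hs => (hd _ _ h1 s (Ico_subset_Icc_self hs)).hasDerivWithinAt)
        (fun s hs => m1 s (Ico_subset_Icc_self hs))
        ((cu _ _ h2).prodMk (cv _ _ h2))
        (fun s hs => (hd _ _ h2 s (Ico_subset_Icc_self hs)).hasDerivWithinAt)
        (fun s hs => m2 s (Ico_subset_Icc_self hs)) ?_
      simp [hc, hu, hv]
    · have hc : d = z := max_eq_left hzs
      refine ODE_solution_unique_of_mem_Icc_left (v := fun _ x => (x.2, GG m T x.1))
        (s := fun _ => Icc lo hi ×ˢ univ) (fun _ _ => hLV)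
        ((cu _ _ h1).prodMk (cv _ _ h1))
        (fun s hs => (hd _ _ h1 s (Ioc_subset_Icc_self hs)).hasDerivWithinAt)
        (fun s hs => m1 s (Ioc_subset_Icc_self hs))
        ((cu _ _ h2).prodMk (cv _ _ h2))
        (fun s hs => (hd _ _ h2 s (Ioc_subset_Icc_self hs)).hasDerivWithinAt)
        (fun s hs => m2 s (Ioc_subset_Icc_self hs)) ?_
      simp [hc, hu, hv]
  have := hEq (show s ∈ Icc c d from ⟨min_le_right _ _, le_max_right _ _⟩)
  exact Prod.mk.inj this

lemma wDist_le_graph (h : WData m U T J) {u v : ℝ → ℝ} {I : Set ℝ} (hI : IsOpen I) {a b : ℝ}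
    (hab : a ≤ b) (hsub : Icc a b ⊆ I) (hJ : ∀ s ∈ Icc a b, u s ∈ J)
    (hu : ∀ s ∈ I, HasDerivAt u (v s) s) (hv : ContinuousOn v I) :
    wDist m (Gr T u a) (Gr T u b) ≤ Len m T u v a b := by
  have cu : ContinuousOn u I := fun s hs => (hu s hs).continuousAt.continuousWithinAt
  have hI' : IsOpen (I ∩ u ⁻¹' J) := cu.isOpen_inter_preimage hI h.Jopen
  have := wDist_le_param m h.mcont (fun s => T (u s)) (fun s => s)
    (fun s => m (T (u s)) ^ 2 * v s) (fun _ => 1) _ hI' hab (fun s hs => ⟨hsub hs, hJ s hs⟩)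
    (fun s hs => (h.Tder _ hs.2).comp s (hu s hs.1)) (fun s _ => hasDerivAt_id s)
    (by
      have cT : ContinuousOn (fun s => T (u s)) (I ∩ u ⁻¹' J) :=
        (Tcont h).comp (cu.mono inter_subset_left) (fun s hs => hs.2)
      exact ((h.mcont.comp_continuousOn cT).pow 2).mul (hv.mono inter_subset_left))
    continuousOn_const
  simp only [FL_eq_spd h] at this
  exact this

lemma exists_delta (hJo : IsOpen J) {u e : ℝ → ℝ} {a b : ℝ} (hu : ContinuousOn u (Icc a b))
    (he : ContinuousOn e (Icc a b)) (hJ : ∀ s ∈ Icc a b, u s ∈ J) :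
    ∃ δ > 0, ∀ l, |l| < δ → ∀ s ∈ Icc a b, u s + l * e s ∈ J := by
  obtain ⟨r, hr, hrJ⟩ := (isCompact_Icc.image_of_continuousOn hu).exists_thickening_subset_open hJo
    (by rintro _ ⟨s, hs, rfl⟩; exact hJ s hs)
  obtain ⟨C, hC⟩ := isCompact_Icc.exists_bound_of_continuousOn he
  have hp : 0 < |C| + 1 := by positivity
  refine ⟨r / (|C| + 1), by positivity, fun l hl s hs => hrJ ?_⟩
  rw [Metric.mem_thickening_iff]
  refine ⟨u s, ⟨s, hs, rfl⟩, ?_⟩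
  rw [Real.dist_eq, add_sub_cancel_left, abs_mul]
  have h1 : |e s| ≤ |C| := (hC s hs).trans (le_abs_self C)
  rw [lt_div_iff₀ hp] at hl
  nlinarith [abs_nonneg l, abs_nonneg (e s)]

lemma Fv_inj (h : WData m U T J) {u v1 v2 : ℝ} (hu : u ∈ J)
    (he : Fv m T u v1 = Fv m T u v2) : v1 = v2 := by
  have : StrictMono (fun v => Fv m T u v) :=
    strictMono_of_hasDerivAt_pos (f' := fun v => Fvv m T u v) (fun x => by
      have := Fvder h (hasDerivAt_const x u) (hasDerivAt_id x) hu
      simpa using this) (fun x => Fvv_pos h u x)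
  exact this.injective he

/-- A minimal curve has no corners. -/
lemma no_corner (h : WData m U T J) {u1 v1 u2 v2 : ℝ → ℝ} {I1 I2 : Set ℝ}
    (hI1 : IsOpen I1) (hI2 : IsOpen I2) (h1 : Sol m T J u1 v1 I1) (h2 : Sol m T J u2 v2 I2)
    {a z b : ℝ} (haz : a < z) (hzb : z < b) (s1 : Icc a z ⊆ I1) (s2 : Icc z b ⊆ I2)
    (hz : u1 z = u2 z)
    (hmin : Len m T u1 v1 a z + Len m T u2 v2 z b ≤ wDist m (Gr T u1 a) (Gr T u2 b)) :
    v1 z = v2 z := by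
  set k := (z - a) / (b - z) with hk
  have hbz : b - z ≠ 0 := by linarith
  have cu1 : ContinuousOn u1 (Icc a z) := fun s hs => (h1 s (s1 hs)).2.1.continuousAt.continuousWithinAt
  have cu2 : ContinuousOn u2 (Icc z b) := fun s hs => (h2 s (s2 hs)).2.1.continuousAt.continuousWithinAt
  have GGc : ∀ (u v : ℝ → ℝ) (I : Set ℝ), Sol m T J u v I → ContinuousOn (fun s => GG m T (u s)) I := by
    intro u v I hh
    have c1 : ContinuousOn u I := fun s hs => (hh s hs).2.1.continuousAt.continuousWithinAt
    exact (cont_comp h c1 c1 (fun s hs => (hh s hs).1)).2.2.2.2.2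
  have hd1 : ∀ s : ℝ, HasDerivAt (fun s => s - a) 1 s := fun s => (hasDerivAt_id s).sub_const a
  have hd2 : ∀ s : ℝ, HasDerivAt (fun s => (b - s) * k) (-k) s := fun s => by
    simpa using ((hasDerivAt_id s).const_sub b).mul_const k
  obtain ⟨δ1, hδ1, hJ1⟩ := exists_delta (e := fun s => s - a) h.Jopen cu1 (by fun_prop)
    (fun s hs => (h1 s (s1 hs)).1)
  obtain ⟨δ2, hδ2, hJ2⟩ := exists_delta (e := fun s => (b - s) * k) h.Jopen cu2 (by fun_prop)
    (fun s hs => (h2 s (s2 hs)).1)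
  have V1 := first_variation h haz.le s1 (fun s hs => (h1 s hs).2.1) (fun s hs => (h1 s hs).2.2)
    (GGc _ _ _ h1) (e := fun s => s - a) (e1 := fun _ => 1) (e2 := fun _ => 0)
    (fun s _ => hd1 s) (fun s _ => hasDerivAt_const s 1) hδ1 hJ1
  have V2 := first_variation h hzb.le s2 (fun s hs => (h2 s hs).2.1) (fun s hs => (h2 s hs).2.2)
    (GGc _ _ _ h2) (e := fun s => (b - s) * k) (e1 := fun _ => -k) (e2 := fun _ => 0)
    (fun s _ => hd2 s) (fun s _ => hasDerivAt_const s (-k)) hδ2 hJ2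
  have V := V1.add V2
  have hlm : IsLocalMin ((fun l => ∫ s in a..z, FL m T (u1 s + l * (s - a)) (v1 s + l * 1)) +
      (fun l => ∫ s in z..b, FL m T (u2 s + l * ((b - s) * k)) (v2 s + l * -k))) 0 := by
    have : Iio (min δ1 δ2) ∈ 𝓝 |(0:ℝ)| := by
      rw [abs_zero]; exact Iio_mem_nhds (lt_min hδ1 hδ2)
    filter_upwards [(continuous_abs.tendsto (0:ℝ)) this] with l hl
    have hl' : |l| < min δ1 δ2 := hl
    have e1 := wDist_le_graph h hI1 haz.le s1 (u := fun s => u1 s + l * (s - a))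
      (v := fun s => v1 s + l * 1) (hJ1 l (hl'.trans_le (min_le_left _ _)))
      (fun s hs => (h1 s hs).2.1.add ((hd1 s).const_mul l))
      (fun s hs => ((h1 s hs).2.2.continuousAt.add continuousAt_const).continuousWithinAt)
    have e2 := wDist_le_graph h hI2 hzb.le s2 (u := fun s => u2 s + l * ((b - s) * k))
      (v := fun s => v2 s + l * -k) (hJ2 l (hl'.trans_le (min_le_right _ _)))
      (fun s hs => (h2 s hs).2.1.add ((hd2 s).const_mul l))
      (fun s hs => ((h2 s hs).2.2.continuousAt.add continuousAt_const).continuousWithinAt)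
    have g1 : Gr T (fun s => u1 s + l * (s - a)) a = Gr T u1 a := by simp [Gr]
    have g2 : Gr T (fun s => u2 s + l * ((b - s) * k)) b = Gr T u2 b := by simp [Gr]
    have g3 : Gr T (fun s => u2 s + l * ((b - s) * k)) z = Gr T (fun s => u1 s + l * (s - a)) z := by
      simp only [Gr, hk, hz]; congr 2; field_simp
    rw [g1] at e1
    rw [g2, g3] at e2
    have tri := wDist_triangle m h.mcont (Gr T u1 a) (Gr T (fun s => u1 s + l * (s - a)) z) (Gr T u2 b)
    simp only [Pi.add_apply, zero_mul, add_zero]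
    have : Len m T u1 v1 a z + Len m T u2 v2 z b ≤ _ := hmin.trans (tri.trans (add_le_add e1 e2))
    exact this
  have h0 := hlm.hasDerivAt_eq_zero V
  simp only [sub_self, mul_zero, zero_mul, intervalIntegral.integral_zero, add_zero, zero_sub, sub_zero] at h0
  have hkz : (b - z) * k = z - a := by rw [hk]; field_simp
  rw [hkz, ← hz] at h0
  have hza : z - a ≠ 0 := by linarith
  apply Fv_inj h (h1 z (s1 ⟨haz.le, le_rfl⟩)).1
  have : (Fv m T (u1 z) (v1 z) - Fv m T (u1 z) (v2 z)) * (z - a) = 0 := by linarith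
  rcases mul_eq_zero.1 this with h | h
  · linarith
  · exact absurd h hza

end

open Real Set
noncomputable section

open Filter Topology MeasureTheory
open scoped Interval NNReal

variable {m U T : ℝ → ℝ} {J : Set ℝ}

lemma exists_WData (hm : ContDiff ℝ (⊤:ℕ∞) m) (hmpos : ∀ t, 0 < m t) :
    ∃ (U T : ℝ → ℝ) (J : Set ℝ), WData m U T J ∧ U 0 = 0 := by
  have hc : Continuous (fun t => (m t ^ 2)⁻¹) :=
    (hm.continuous.pow 2).inv₀ fun t => (pow_pos (hmpos t) 2).ne'
  have hU : ∀ t, HasDerivAt (fun t => ∫ x in (0:ℝ)..t, (m x ^ 2)⁻¹) ((m t ^ 2)⁻¹) t := fun t =>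
    (hc.integral_hasStrictDerivAt 0 t).hasDerivAt
  obtain ⟨T, h1, h2, h3, h4, h5⟩ := inv_aux _ _ hU (fun t => inv_pos.2 (pow_pos (hmpos t) 2))
  refine ⟨_, T, _, ⟨hm.continuous, hmpos, fun t => ((hm.differentiable (by simp)) t).hasDerivAt,
    hm.continuous_deriv (by simp), h3, h4, fun t => ⟨t, rfl⟩, h2, fun u hu => (h5 u hu).1, h1, hU,
    fun u hu => by simpa using (h5 u hu).2⟩, by simp⟩

lemma GG_deriv (h : WData m U T J) (hm : ContDiff ℝ (⊤:ℕ∞) m) {u : ℝ} (hu : u ∈ J) :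
    HasDerivAt (GG m T) (-(deriv m (T u) ^ 2 - m (T u) * deriv (deriv m) (T u))) u := by
  have h2 : ContDiff ℝ (⊤:ℕ∞) (deriv m) := ((contDiff_infty_iff_deriv (𝕜 := ℝ)).1 hm).2
  have d2 : HasDerivAt (deriv m) (deriv (deriv m) (T u)) (T u) :=
    ((h2.differentiable (by simp)) _).hasDerivAt
  have h0 := (h.mpos (T u)).ne'
  have := (d2.comp u (h.Tder u hu)).div ((h.mder (T u)).comp u (h.Tder u hu)) h0
  refine this.congr_deriv ?_
  simp only [Function.comp]
  field_simp
  ring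

lemma Q_mono (hm : ContDiff ℝ (⊤:ℕ∞) m) (hmpos : ∀ t, 0 < m t)
    (hmeven : ∀ t, m (-t) = m t) (hKdec : AntitoneOn (gaussK m) (Ici 0)) :
    MonotoneOn (fun t => deriv m t ^ 2 - m t * deriv (deriv m) t) (Iic 0) := by
  have s1 : ContDiff ℝ (⊤:ℕ∞) (deriv m) := ((contDiff_infty_iff_deriv (𝕜 := ℝ)).1 hm).2
  have s2 : ContDiff ℝ (⊤:ℕ∞) (deriv (deriv m)) := ((contDiff_infty_iff_deriv (𝕜 := ℝ)).1 s1).2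
  have d0 : ∀ t, HasDerivAt m (deriv m t) t := fun t => ((hm.differentiable (by simp)) t).hasDerivAt
  have d1 : ∀ t, HasDerivAt (deriv m) (deriv (deriv m) t) t := fun t =>
    ((s1.differentiable (by simp)) t).hasDerivAt
  have d2 : ∀ t, HasDerivAt (deriv (deriv m)) (deriv (deriv (deriv m)) t) t := fun t =>
    ((s2.differentiable (by simp)) t).hasDerivAt
  have o1 : ∀ t, deriv m (-t) = - deriv m t := by
    intro t
    have h1 : HasDerivAt (fun t => m (-t)) (deriv m (-t) * (-1)) t :=
      (d0 (-t)).comp t (hasDerivAt_neg t)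
    have h2 : (fun t => m (-t)) = m := funext hmeven
    rw [h2] at h1
    have := h1.unique (d0 t)
    linarith
  have o2 : ∀ t, deriv (deriv m) (-t) = deriv (deriv m) t := by
    intro t
    have h1 : HasDerivAt (fun t => deriv m (-t)) (deriv (deriv m) (-t) * (-1)) t :=
      (d1 (-t)).comp t (hasDerivAt_neg t)
    have h2 : (fun t => deriv m (-t)) = fun t => - deriv m t := funext o1
    rw [h2] at h1
    have := h1.unique (d1 t).neg
    linarith
  have Kev : ∀ t, gaussK m (-t) = gaussK m t := fun t => by unfold gaussK; rw [o2, hmeven]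
  have Kmono : MonotoneOn (gaussK m) (Iic 0) := by
    intro a ha b hb hab
    rw [← Kev a, ← Kev b]
    simp only [mem_Iic] at ha hb
    exact hKdec (by simpa using hb) (by simpa using ha) (by linarith)
  have Kd : ∀ t, HasDerivAt (gaussK m)
      ((deriv m t * deriv (deriv m) t - m t * deriv (deriv (deriv m)) t) / m t ^ 2) t := by
    intro t
    refine ((d2 t).neg.div (d0 t) (hmpos t).ne').congr_deriv ?_
    simp only [Pi.neg_apply]
    ring
  have Qd : ∀ t, HasDerivAt (fun t => deriv m t ^ 2 - m t * deriv (deriv m) t)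
      (deriv m t * deriv (deriv m) t - m t * deriv (deriv (deriv m)) t) t := by
    intro t
    refine (((d1 t).pow 2).sub ((d0 t).mul (d2 t))).congr_deriv ?_
    simp
    ring
  refine monotoneOn_of_deriv_nonneg (convex_Iic 0)
    (fun t _ => (Qd t).continuousAt.continuousWithinAt)
    (fun t _ => (Qd t).differentiableAt.differentiableWithinAt) fun t ht => ?_
  rw [interior_Iic, mem_Iio] at ht
  rw [(Qd t).deriv]
  have := Kmono.derivWithin_nonneg (x := t)
  rw [derivWithin_of_mem_nhds (Iic_mem_nhds ht), (Kd t).deriv] at this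
  have hp := pow_pos (hmpos t) 2
  have h3 := mul_nonneg this hp.le
  rwa [div_mul_cancel₀ _ hp.ne'] at h3

lemma GG_concave (h : WData m U T J) (hU0 : U 0 = 0) (hm : ContDiff ℝ (⊤:ℕ∞) m)
    (hmeven : ∀ t, m (-t) = m t) (hKdec : AntitoneOn (gaussK m) (Ici 0)) :
    ConcaveOn ℝ (J ∩ Iic 0) (GG m T) := by
  have hT : MonotoneOn T J := by
    intro a ha b hb hab
    rw [← h.Umono.le_iff_le, h.UT a ha, h.UT b hb]; exact hab
  have hQ := Q_mono hm h.mpos hmeven hKdec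
  have hT0 : T 0 = 0 := by have := h.TU 0; rwa [hU0] at this
  have h0J : (0:ℝ) ∈ J := hU0 ▸ h.UJ 0
  refine AntitoneOn.concaveOn_of_deriv ((h.Jord.inter ordConnected_Iic).convex)
    (fun u hu => (GG_deriv h hm hu.1).continuousAt.continuousWithinAt)
    (fun u hu => (GG_deriv h hm (interior_subset hu).1).differentiableAt.differentiableWithinAt) ?_
  intro a ha b hb hab
  have ha' := interior_subset ha
  have hb' := interior_subset hb
  rw [(GG_deriv h hm ha'.1).deriv, (GG_deriv h hm hb'.1).deriv]
  have ta : T a ≤ 0 := by rw [← hT0]; exact hT ha'.1 h0J ha'.2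
  have tb : T b ≤ 0 := by rw [← hT0]; exact hT hb'.1 h0J hb'.2
  exact neg_le_neg (hQ ta tb (hT ha'.1 hb'.1 hab))

lemma g_cont (h : WData m U T J) (hm : ContDiff ℝ (⊤:ℕ∞) m) :
    ContinuousOn (fun u => -(deriv m (T u) ^ 2 - m (T u) * deriv (deriv m) (T u))) J := by
  have s1 : ContDiff ℝ (⊤:ℕ∞) (deriv m) := ((contDiff_infty_iff_deriv (𝕜 := ℝ)).1 hm).2
  have s2 : ContDiff ℝ (⊤:ℕ∞) (deriv (deriv m)) := ((contDiff_infty_iff_deriv (𝕜 := ℝ)).1 s1).2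
  exact (((s1.continuous.comp_continuousOn (Tcont h)).pow 2).sub
    ((hm.continuous.comp_continuousOn (Tcont h)).mul (s2.continuous.comp_continuousOn (Tcont h)))).neg

lemma geo_derivs {γ : ℝ → ℝ × ℝ} (hγ : IsUnitGeodesic m γ) :
    (∀ s, HasDerivAt (fun u => (γ u).1) (deriv (fun u => (γ u).1) s) s) ∧
    (∀ s, HasDerivAt (fun u => (γ u).2) (deriv (fun u => (γ u).2) s) s) ∧
    (∀ s, HasDerivAt (deriv (fun u => (γ u).1)) (m (γ s).1 * deriv m (γ s).1 * (deriv (fun u => (γ u).2) s) ^ 2) s) := by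
  have c1 : ContDiff ℝ 2 (fun u => (γ u).1) := hγ.1.fst
  have c2 : ContDiff ℝ 2 (fun u => (γ u).2) := hγ.1.snd
  refine ⟨fun s => (c1.differentiable (by simp) s).hasDerivAt,
    fun s => (c2.differentiable (by simp) s).hasDerivAt, fun s => ?_⟩
  rw [← hγ.2.1 s]
  have : ContDiff ℝ 1 (deriv (fun u => (γ u).1)) := by
    have := (contDiff_succ_iff_deriv (n := 1) (f := fun u => (γ u).1)).1 (by simpa [one_add_one_eq_two] using c1)
    exact this.2.2
  exact (this.differentiable (by simp) s).hasDerivAt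

lemma geo_graph (h : WData m U T J) {γ : ℝ → ℝ × ℝ} (hγ : IsUnitGeodesic m γ) {L : ℝ}
    (hL : 0 < L) (hlt : (γ 0).2 < (γ L).2) :
    ∃ (u v : ℝ → ℝ) (I : Set ℝ), IsOpen I ∧ OrdConnected I ∧ Sol m T J u v I ∧
      StrictMono (fun s => (γ s).2) ∧ I = range (fun s => (γ s).2) ∧
      (∀ s, Gr T u (γ s).2 = γ s) ∧ (∀ s, u (γ s).2 = U (γ s).1) ∧
      (∀ s1 s2, Len m T u v (γ s1).2 (γ s2).2 = s2 - s1) := by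
  obtain ⟨d1, d2, d3⟩ := geo_derivs hγ
  obtain ⟨-, -, ⟨ν, hν⟩, hunit⟩ := hγ
  have hm0 := h.mpos
  have hd : ∀ s, deriv (fun u => (γ u).2) s = ν / m (γ s).1 ^ 2 := fun s => by
    rw [eq_div_iff (pow_pos (hm0 _) 2).ne', mul_comm]; exact hν s
  have hνpos : 0 < ν := by
    by_contra hneg
    push Not at hneg
    have : Antitone (fun s => (γ s).2) := antitone_of_deriv_nonpos (fun s => (d2 s).differentiableAt)
      (fun s => by rw [hd]; exact div_nonpos_of_nonpos_of_nonneg hneg (by positivity))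
    exact absurd (this hL.le) (not_le.2 hlt)
  simp only [hd] at d2 d3 hunit
  obtain ⟨S, i1, i2, i3, i4, i5⟩ := inv_aux _ _ d2 (fun s => div_pos hνpos (pow_pos (hm0 _) 2))
  have hS : ∀ s, S (γ s).2 = s := i2
  have hu : ∀ τ ∈ range (fun s => (γ s).2), HasDerivAt (fun τ => U (γ (S τ)).1)
      (deriv (fun u => (γ u).1) (S τ) / ν) τ := by
    intro τ hτ
    have e1 := (d1 (S τ)).comp τ (i5 τ hτ).2
    have := (h.Uder (γ (S τ)).1).comp τ e1
    refine this.congr_deriv ?_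
    have := (hm0 (γ (S τ)).1).ne'
    field_simp
  have hsol : Sol m T J (fun τ => U (γ (S τ)).1) (fun τ => deriv (fun u => (γ u).1) (S τ) / ν)
      (range (fun s => (γ s).2)) := by
    intro τ hτ
    refine ⟨h.UJ _, hu τ hτ, ?_⟩
    have := ((d3 (S τ)).comp τ (i5 τ hτ).2).div_const ν
    refine this.congr_deriv ?_
    have := (hm0 (γ (S τ)).1).ne'
    simp only [GG, h.TU]
    field_simp
  refine ⟨fun τ => U (γ (S τ)).1, fun τ => deriv (fun u => (γ u).1) (S τ) / ν, _, i3, i4, hsol, i1, rfl,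
    fun s => ?_, fun s => ?_, fun s1 s2 => ?_⟩
  · simp only [Gr, hS, h.TU]
  · simp only [hS]
  · unfold Len
    have hF : ∀ τ, FL m T (U (γ (S τ)).1) (deriv (fun u => (γ u).1) (S τ) / ν) = (ν / m (γ (S τ)).1 ^ 2)⁻¹ := by
      intro τ
      have hp := hm0 (γ (S τ)).1
      have hu := hunit (S τ)
      simp only [FL, FR, h.TU]
      generalize deriv (fun u => (γ u).1) (S τ) = t at *
      generalize m (γ (S τ)).1 = M at *
      have : 1 + M ^ 2 * (t / ν) ^ 2 = (M / ν) ^ 2 := by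
        have hne := hp.ne'
        have : t ^ 2 = 1 - M ^ 2 * (ν / M ^ 2) ^ 2 := by linarith
        rw [div_pow, this]
        field_simp
        ring
      rw [this, Real.sqrt_sq (by positivity)]
      field_simp
    simp only [hF]
    have hsub := i4.uIcc_subset (mem_range_self s1) (mem_range_self s2)
    rw [intervalIntegral.integral_eq_sub_of_hasDerivAt (fun τ hτ => (i5 τ (hsub hτ)).2), hS, hS]
    apply ContinuousOn.intervalIntegrable
    have cS : ContinuousOn S (uIcc (γ s1).2 (γ s2).2) := fun τ hτ =>
      (i5 τ (hsub hτ)).2.continuousAt.continuousWithinAt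
    have c1 : Continuous (fun s => (γ s).1) := continuous_iff_continuousAt.2 fun s => (d1 s).continuousAt
    have cm : Continuous (fun s => (ν / m (γ s).1 ^ 2)⁻¹) :=
      Continuous.inv₀ (continuous_const.div ((h.mcont.comp c1).pow 2) (fun s => (pow_pos (hm0 _) 2).ne'))
        (fun s => (div_pos hνpos (pow_pos (hm0 _) 2)).ne')
    exact cm.comp_continuousOn cS

end

open Real Set
noncomputable section

open Filter Topology MeasureTheory
open scoped Interval NNReal

variable {m U T : ℝ → ℝ} {J : Set ℝ}

lemma topo1 {f g : ℝ → ℝ} {a b : ℝ} (hf : ContinuousOn f (Icc a b)) (hg : ContinuousOn g (Icc a b))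
    {x : ℝ × ℝ} (hx : x.2 ∈ Icc a b → x.1 ≠ f x.2 ∧ x.1 ≠ g x.2)
    (hC : ∀ C : Set (ℝ × ℝ), IsPreconnected C → x ∈ C →
      (∀ z ∈ C, z.2 ∈ Icc a b → z.1 ≠ f z.2 ∧ z.1 ≠ g z.2) → ∀ z ∈ C, z.1 < 0) :
    x.2 ∈ Icc a b ∧ (f x.2 < x.1 ∧ x.1 < g x.2 ∨ g x.2 < x.1 ∧ x.1 < f x.2) := by
  have hmem : x.2 ∈ Icc a b := by
    by_contra hn
    have := hC (univ ×ˢ {x.2}) (isPreconnected_univ.prod isPreconnected_singleton) (by simp)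
      (fun z hz hz2 => absurd (by simpa using hz.2 ▸ hz2) hn) (0, x.2) (by simp)
    simp at this
  refine ⟨hmem, ?_⟩
  obtain ⟨n1, n2⟩ := hx hmem
  have hup : ¬ (f x.2 < x.1 ∧ g x.2 < x.1) := by
    rintro ⟨k1, k2⟩
    have := hC (Ici x.1 ×ˢ {x.2}) (isPreconnected_Ici.prod isPreconnected_singleton) (by simp)
      (fun z hz _ => by
        obtain ⟨z1, z2⟩ := z
        simp only [mem_prod, mem_Ici, mem_singleton_iff] at hz
        obtain ⟨h1, rfl⟩ := hz
        exact ⟨(k1.trans_le h1).ne', (k2.trans_le h1).ne'⟩) (max x.1 0, x.2) (by simp)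
    simp at this
  have hdown : ¬ (x.1 < f x.2 ∧ x.1 < g x.2) := by
    rintro ⟨k1, k2⟩
    obtain ⟨c1, hc1⟩ := isCompact_Icc.bddBelow_image hf
    obtain ⟨c2, hc2⟩ := isCompact_Icc.bddBelow_image hg
    set c := min (min c1 c2 - 1) x.1 with hc
    have cx : c ≤ x.1 := min_le_right _ _
    have l1 : ∀ τ ∈ Icc a b, c < f τ := fun τ hτ => by
      have : c1 ≤ f τ := hc1 ⟨τ, hτ, rfl⟩
      have : c ≤ min c1 c2 - 1 := min_le_left _ _
      have := min_le_left c1 c2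
      linarith
    have l2 : ∀ τ ∈ Icc a b, c < g τ := fun τ hτ => by
      have : c2 ≤ g τ := hc2 ⟨τ, hτ, rfl⟩
      have : c ≤ min c1 c2 - 1 := min_le_left _ _
      have := min_le_right c1 c2
      linarith
    have P : IsPreconnected ((Iic x.1 ×ˢ {x.2}) ∪ ({c} ×ˢ univ) ∪ (univ ×ˢ {b + 1}) : Set (ℝ × ℝ)) := by
      refine IsPreconnected.union (c, b + 1) (by simp) (by simp) ?_ ?_
      · refine IsPreconnected.union (c, x.2) (by simp [cx]) (by simp) ?_ ?_
        · exact isPreconnected_Iic.prod isPreconnected_singleton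
        · exact isPreconnected_singleton.prod isPreconnected_univ
      · exact isPreconnected_univ.prod isPreconnected_singleton
    have := hC _ P (by simp) (fun z hz hz2 => by
        obtain ⟨z1, z2⟩ := z
        simp only [mem_union, mem_prod, mem_Iic, mem_singleton_iff, mem_univ, and_true, true_and] at hz
        simp only at hz2 ⊢
        rcases hz with (⟨h1, rfl⟩ | rfl) | rfl
        · exact ⟨(h1.trans_lt k1).ne, (h1.trans_lt k2).ne⟩
        · exact ⟨(l1 _ hz2).ne, (l2 _ hz2).ne⟩
        · exact absurd hz2.2 (by linarith)) (0, b + 1) (by simp)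
    simp at this
  rcases lt_or_gt_of_ne n1 with q1 | q1 <;> rcases lt_or_gt_of_ne n2 with q2 | q2
  · exact absurd ⟨q1, q2⟩ hdown
  · exact Or.inr ⟨q2, q1⟩
  · exact Or.inl ⟨q1, q2⟩
  · exact absurd ⟨q1, q2⟩ hup

lemma topo2 {f g : ℝ → ℝ} {a b : ℝ} (hf : ContinuousOn f (Icc a b)) (hg : ContinuousOn g (Icc a b))
    {x : ℝ × ℝ} (hxI : x.2 ∈ Ioo a b) (hx : g x.2 < x.1 ∧ x.1 < f x.2)
    (hlt : ∀ τ ∈ Ioo a b, g τ < f τ)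
    (hC : ∀ C : Set (ℝ × ℝ), IsPreconnected C → x ∈ C →
      (∀ z ∈ C, z.2 ∈ Icc a b → z.1 ≠ f z.2 ∧ z.1 ≠ g z.2) → ∀ z ∈ C, z.1 < 0) :
    ∀ τ ∈ Ioo a b, f τ ≤ 0 := by
  set F : ℝ × ℝ → ℝ × ℝ := fun q => (g q.1 + q.2 * (f q.1 - g q.1), q.1)
  have hfo := hf.mono Ioo_subset_Icc_self
  have hgo := hg.mono Ioo_subset_Icc_self
  have cf : ContinuousOn (fun q : ℝ × ℝ => f q.1) (Ioo a b ×ˢ Ioo (0:ℝ) 1) :=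
    hfo.comp continuousOn_fst (fun q hq => hq.1)
  have cg : ContinuousOn (fun q : ℝ × ℝ => g q.1) (Ioo a b ×ˢ Ioo (0:ℝ) 1) :=
    hgo.comp continuousOn_fst (fun q hq => hq.1)
  have P : IsPreconnected (F '' (Ioo a b ×ˢ Ioo (0:ℝ) 1)) :=
    (isPreconnected_Ioo.prod isPreconnected_Ioo).image F
      ((cg.add (continuousOn_snd.mul (cf.sub cg))).prodMk continuousOn_fst)
  have hd : ∀ τ ∈ Ioo a b, 0 < f τ - g τ := fun τ hτ => sub_pos.2 (hlt τ hτ)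
  have key := hC _ P ⟨(x.2, (x.1 - g x.2) / (f x.2 - g x.2)), ⟨hxI, by
      have := hd _ hxI
      constructor
      · exact div_pos (by linarith) this
      · rw [div_lt_one this]; linarith⟩, by
      have := (hd _ hxI).ne'
      ext
      · simp only [F]; field_simp; ring
      · rfl⟩ (by
      rintro _ ⟨⟨τ, l⟩, ⟨hτ, hl⟩, rfl⟩ -
      have := hd _ hτ
      simp only at hτ hl this
      simp only [F]
      constructor
      · apply ne_of_lt; nlinarith [hl.2]
      · apply ne_of_gt; nlinarith [hl.1])
  intro τ hτ
  by_contra hn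
  push Not at hn
  have h0 := hd _ hτ
  set t := max ((f τ + g τ) / 2) (f τ / 2) with ht
  have t1 : t < f τ := max_lt (by linarith) (by linarith)
  have t2 : g τ < t := lt_of_lt_of_le (by linarith) (le_max_left _ _)
  have t3 : 0 < t := lt_of_lt_of_le (by linarith) (le_max_right _ _)
  have := key (t, τ) ⟨(τ, (t - g τ) / (f τ - g τ)), ⟨hτ, by
      constructor
      · exact div_pos (by linarith) h0
      · rw [div_lt_one h0]; linarith⟩, by
      have := h0.ne'
      ext
      · simp only [F]; field_simp; ring
      · rfl⟩
  simp only at this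
  linarith

/-- `C¹` curves in graph form. -/
def Cur (J : Set ℝ) (u v : ℝ → ℝ) (I : Set ℝ) : Prop :=
  IsOpen I ∧ (∀ s ∈ I, u s ∈ J) ∧ (∀ s ∈ I, HasDerivAt u (v s) s) ∧ ContinuousOn v I

lemma Sol.cur {u v : ℝ → ℝ} {I : Set ℝ} (h : Sol m T J u v I) (hI : IsOpen I) : Cur J u v I :=
  ⟨hI, fun s hs => (h s hs).1, fun s hs => (h s hs).2.1,
    fun s hs => (h s hs).2.2.continuousAt.continuousWithinAt⟩

lemma Cur.ucont {u v : ℝ → ℝ} {I : Set ℝ} (c : Cur J u v I) : ContinuousOn u I :=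
  fun s hs => (c.2.2.1 s hs).continuousAt.continuousWithinAt

lemma Cur.le (h : WData m U T J) {u v : ℝ → ℝ} {I : Set ℝ} (c : Cur J u v I) {a b : ℝ}
    (hab : a ≤ b) (hs : Icc a b ⊆ I) : wDist m (Gr T u a) (Gr T u b) ≤ Len m T u v a b :=
  wDist_le_graph h c.1 hab hs (fun s h => c.2.1 s (hs h)) c.2.2.1 c.2.2.2

lemma Cur.add (h : WData m U T J) {u v : ℝ → ℝ} {I : Set ℝ} (c : Cur J u v I) {a z b : ℝ}
    (haz : a ≤ z) (hzb : z ≤ b) (hs : Icc a b ⊆ I) :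
    Len m T u v a z + Len m T u v z b = Len m T u v a b := by
  have hc := (cont_comp h c.ucont c.2.2.2 c.2.1).1
  apply intervalIntegral.integral_add_adjacent_intervals
  · apply ContinuousOn.intervalIntegrable
    rw [uIcc_of_le haz]
    exact hc.mono ((Icc_subset_Icc_right hzb).trans hs)
  · apply ContinuousOn.intervalIntegrable
    rw [uIcc_of_le hzb]
    exact hc.mono ((Icc_subset_Icc_left haz).trans hs)

lemma Cur.min_sub (h : WData m U T J) {u v : ℝ → ℝ} {I : Set ℝ} (c : Cur J u v I) {a z b : ℝ}
    (haz : a ≤ z) (hzb : z ≤ b) (hs : Icc a b ⊆ I)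
    (hmin : Len m T u v a b ≤ wDist m (Gr T u a) (Gr T u b)) :
    Len m T u v a z ≤ wDist m (Gr T u a) (Gr T u z) := by
  have h1 := c.add h haz hzb hs
  have h2 := wDist_triangle m h.mcont (Gr T u a) (Gr T u z) (Gr T u b)
  have h3 := c.le h hzb ((Icc_subset_Icc_left haz).trans hs)
  linarith

lemma meet (h : WData m U T J) {u1 v1 u2 v2 : ℝ → ℝ} {I1 I2 I3 : Set ℝ}
    (h1 : Sol m T J u1 v1 I1) (hI1 : IsOpen I1) (c2 : Cur J u2 v2 I2) (h2 : Sol m T J u2 v2 I3)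
    (hI3 : IsOpen I3) {a z b : ℝ} (haz : a < z) (hzb : z < b) (s1 : Icc a z ⊆ I1)
    (s2 : Icc a b ⊆ I2) (s3 : Icc z b ⊆ I3) (ha : u1 a = u2 a) (hz : u1 z = u2 z)
    (m1 : Len m T u1 v1 a z ≤ wDist m (Gr T u1 a) (Gr T u1 z))
    (m2 : Len m T u2 v2 a b ≤ wDist m (Gr T u2 a) (Gr T u2 b)) : v1 z = v2 z := by
  refine no_corner h hI1 hI3 h1 h2 haz hzb s1 s3 hz ?_
  have e1 : Gr T u1 a = Gr T u2 a := by simp [Gr, ha]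
  have e2 : Gr T u1 z = Gr T u2 z := by simp [Gr, hz]
  rw [e1, e2] at m1
  rw [e1]
  have h3 := c2.add h haz.le hzb.le s2
  have h4 := c2.le h haz.le ((Icc_subset_Icc_right hzb.le).trans s2)
  linarith

/-- The convexity argument: if `u1`, `u2` are two minimal solutions with common ends in the
concave region, then all convex combinations are minimal solutions. -/
lemma conv_core (h : WData m U T J) (hconc : ConcaveOn ℝ (J ∩ Iic 0) (GG m T))
    {u1 v1 u2 v2 : ℝ → ℝ} {I : Set ℝ} (hI : IsOpen I)
    (h1 : Sol m T J u1 v1 I) (h2 : Sol m T J u2 v2 I) {a b : ℝ} (hab : a < b)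
    (hs : Icc a b ⊆ I) (ha : u1 a = u2 a) (hb : u1 b = u2 b)
    (hlt : ∀ s ∈ Ioo a b, u2 s < u1 s) (hneg : ∀ s ∈ Icc a b, u1 s ≤ 0)
    (hlen : Len m T u1 v1 a b = Len m T u2 v2 a b) {l : ℝ} (hl : l ∈ Ioo (0:ℝ) 1) :
    Cur J (fun s => u1 s + l * (u2 s - u1 s)) (fun s => v1 s + l * (v2 s - v1 s)) I ∧
    Sol m T J (fun s => u1 s + l * (u2 s - u1 s)) (fun s => v1 s + l * (v2 s - v1 s)) (Ioo a b) ∧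
    Len m T (fun s => u1 s + l * (u2 s - u1 s)) (fun s => v1 s + l * (v2 s - v1 s)) a b =
      Len m T u1 v1 a b := by
  have hJconv : Convex ℝ J := h.Jord.convex
  have hmemJ : ∀ l ∈ Icc (0:ℝ) 1, ∀ s ∈ I, u1 s + l * (u2 s - u1 s) ∈ J := fun l hl s hs => by
    have := hJconv (h1 s hs).1 (h2 s hs).1 (a := 1 - l) (b := l) (by linarith [hl.2]) hl.1 (by ring)
    simp only [smul_eq_mul] at this
    convert this using 1; ring
  have dU : ∀ l, ∀ s ∈ I, HasDerivAt (fun s => u1 s + l * (u2 s - u1 s)) (v1 s + l * (v2 s - v1 s)) s :=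
    fun l s hs => (h1 s hs).2.1.add (((h2 s hs).2.1.sub (h1 s hs).2.1).const_mul l)
  have dV : ∀ l, ∀ s ∈ I, HasDerivAt (fun s => v1 s + l * (v2 s - v1 s))
      (GG m T (u1 s) + l * (GG m T (u2 s) - GG m T (u1 s))) s :=
    fun l s hs => (h1 s hs).2.2.add (((h2 s hs).2.2.sub (h1 s hs).2.2).const_mul l)
  have cU : ∀ l, ContinuousOn (fun s => u1 s + l * (u2 s - u1 s)) I :=
    fun l s hs => (dU l s hs).continuousAt.continuousWithinAt
  have cV : ∀ l, ContinuousOn (fun s => v1 s + l * (v2 s - v1 s)) I :=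
    fun l s hs => (dV l s hs).continuousAt.continuousWithinAt
  have c1 := (h1.cur hI).ucont
  have c2 := (h2.cur hI).ucont
  have cG1 := (cont_comp h c1 c1 (fun s hs => (h1 s hs).1)).2.2.2.2.2
  have cG2 := (cont_comp h c2 c2 (fun s hs => (h2 s hs).1)).2.2.2.2.2
  have cW : ∀ l : ℝ, ContinuousOn (fun s => GG m T (u1 s) + l * (GG m T (u2 s) - GG m T (u1 s))) I :=
    fun l => cG1.add (continuousOn_const.mul (cG2.sub cG1))
  set φ : ℝ → ℝ := fun l => ∫ s in a..b, FL m T (u1 s + l * (u2 s - u1 s)) (v1 s + l * (v2 s - v1 s)) with hφ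
  set E : ℝ → ℝ → ℝ := fun l s => Fvv m T (u1 s + l * (u2 s - u1 s)) (v1 s + l * (v2 s - v1 s)) *
    (GG m T (u1 s + l * (u2 s - u1 s)) - (GG m T (u1 s) + l * (GG m T (u2 s) - GG m T (u1 s)))) *
      (u2 s - u1 s) with hE
  have hφd : ∀ l ∈ Icc (0:ℝ) 1, HasDerivAt φ (∫ s in a..b, E l s) l := by
    intro l hl
    obtain ⟨δ, hδ, hJδ⟩ := exists_delta (e := fun s => u2 s - u1 s) h.Jopen ((cU l).mono hs)
      ((c2.sub c1).mono hs) (fun s hs' => hmemJ l hl s (hs hs'))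
    have V := first_variation h hab.le hs (dU l) (dV l) (cW l)
      (fun s hs => (h2 s hs).2.1.sub (h1 s hs).2.1) (fun s hs => (h2 s hs).2.2.sub (h1 s hs).2.2)
      hδ hJδ
    have ea : u2 a - u1 a = 0 := by rw [ha]; ring
    have eb : u2 b - u1 b = 0 := by rw [hb]; ring
    simp only [Pi.sub_apply, ea, eb, mul_zero, sub_zero, zero_add] at V
    rw [← sub_self l] at V
    have V2 := V.comp_sub_const l l
    refine V2.congr_of_eventuallyEq (Eventually.of_forall fun r => ?_)
    simp only [hφ]
    congr 1
    ext s
    congr 1 <;> ring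
  have hG : ∀ l ∈ Icc (0:ℝ) 1, ∀ s ∈ Icc a b, GG m T (u1 s) + l * (GG m T (u2 s) - GG m T (u1 s)) ≤
      GG m T (u1 s + l * (u2 s - u1 s)) := by
    intro l hl s hs'
    have h21 : u2 s ≤ u1 s := by
      rcases eq_or_lt_of_le hs'.1 with e | e
      · rw [← e, ha]
      rcases eq_or_lt_of_le hs'.2 with e' | e'
      · rw [e', hb]
      exact (hlt s ⟨e, e'⟩).le
    have := hconc.2 (show u1 s ∈ J ∩ Iic 0 from ⟨(h1 s (hs hs')).1, hneg s hs'⟩)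
      (show u2 s ∈ J ∩ Iic 0 from ⟨(h2 s (hs hs')).1, h21.trans (hneg s hs')⟩)
      (show 0 ≤ 1 - l by linarith [hl.2]) hl.1 (by ring)
    simp only [smul_eq_mul] at this
    rw [show u1 s + l * (u2 s - u1 s) = (1 - l) * u1 s + l * u2 s by ring]
    linarith
  have hE0 : ∀ l ∈ Icc (0:ℝ) 1, ∀ s ∈ Icc a b, E l s ≤ 0 := by
    intro l hl s hs'
    have h21 : u2 s ≤ u1 s := by
      rcases eq_or_lt_of_le hs'.1 with e | e
      · rw [← e, ha]
      rcases eq_or_lt_of_le hs'.2 with e' | e'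
      · rw [e', hb]
      exact (hlt s ⟨e, e'⟩).le
    exact mul_nonpos_of_nonneg_of_nonpos (mul_nonneg (Fvv_pos h _ _).le (sub_nonneg.2 (hG l hl s hs')))
      (by linarith)
  have hanti : AntitoneOn φ (Icc 0 1) := by
    refine antitoneOn_of_deriv_nonpos (convex_Icc 0 1)
      (fun l hl => (hφd l hl).continuousAt.continuousWithinAt)
      (fun l hl => (hφd l (interior_subset hl)).differentiableAt.differentiableWithinAt) fun l hl => ?_
    rw [(hφd l (interior_subset hl)).deriv]
    have := intervalIntegral.integral_nonneg (μ := volume) hab.le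
      (fun s hs' => neg_nonneg.2 (hE0 l (interior_subset hl) s hs'))
    rw [intervalIntegral.integral_neg] at this
    linarith
  have e0 : φ 0 = Len m T u1 v1 a b := by simp [hφ, Len]
  have e1 : φ 1 = Len m T u1 v1 a b := by rw [hlen]; simp [hφ, Len]
  have hconst : ∀ l ∈ Icc (0:ℝ) 1, φ l = Len m T u1 v1 a b := fun l hl => by
    apply le_antisymm
    · rw [← e0]; exact hanti (by simp) hl hl.1
    · rw [← e1]; exact hanti hl (by simp) hl.2
  have hlI := Ioo_subset_Icc_self hl
  refine ⟨⟨hI, hmemJ l hlI, dU l, cV l⟩, ?_, hconst l hlI⟩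
  have hzero : ∫ s in a..b, E l s = 0 := by
    have hc : HasDerivAt φ 0 l := by
      refine (hasDerivAt_const l (Len m T u1 v1 a b)).congr_of_eventuallyEq ?_
      filter_upwards [Ioo_mem_nhds hl.1 hl.2] with r hr
      exact hconst r (Ioo_subset_Icc_self hr)
    exact (hφd l hlI).unique hc
  have hEc : ContinuousOn (E l) (Icc a b) := by
    have cc := cont_comp h (cU l) (cV l) (hmemJ l hlI)
    exact (((cc.2.2.2.1).mul (cc.2.2.2.2.2.sub (cW l))).mul (c2.sub c1)).mono hs
  intro s hs'
  have hsI := hs (Ioo_subset_Icc_self hs')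
  refine ⟨hmemJ l hlI s hsI, dU l s hsI, (dV l s hsI).congr_deriv ?_⟩
  refine le_antisymm (hG l hlI s (Ioo_subset_Icc_self hs')) ?_
  by_contra hn
  push Not at hn
  have hneg' : E l s < 0 :=
    mul_neg_of_pos_of_neg (mul_pos (Fvv_pos h _ _) (sub_pos.2 hn)) (sub_neg.2 (hlt s hs'))
  have := intervalIntegral.integral_pos hab hEc.neg
    (fun r hr => neg_nonneg.2 (hE0 l hlI r (Ioc_subset_Icc_self hr)))
    ⟨s, Ioo_subset_Icc_self hs', neg_pos.2 hneg'⟩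
  rw [show (∫ r in a..b, (-E l) r) = -∫ r in a..b, E l r from intervalIntegral.integral_neg, hzero] at this
  linarith

end

open Real Set
noncomputable section

open Filter Topology MeasureTheory
open scoped Interval NNReal

variable {m U T : ℝ → ℝ} {J : Set ℝ}

lemma core_ordered (h : WData m U T J) (hU0 : U 0 = 0) (hm : ContDiff ℝ (⊤:ℕ∞) m)
    (hmeven : ∀ t, m (-t) = m t) (hKdec : AntitoneOn (gaussK m) (Ici 0))
    {u1 v1 u2 v2 : ℝ → ℝ} {I1 I2 : Set ℝ} (o1 : IsOpen I1) (o2 : IsOpen I2)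
    (r1 : OrdConnected I1) (r2 : OrdConnected I2)
    (h1 : Sol m T J u1 v1 I1) (h2 : Sol m T J u2 v2 I2) {a b : ℝ} (hab : a < b)
    (s1 : Icc a b ⊆ I1) (s2 : Icc a b ⊆ I2) (ha : u1 a = u2 a) (hb : u1 b = u2 b)
    (m1 : Len m T u1 v1 a b ≤ wDist m (Gr T u1 a) (Gr T u1 b))
    (m2 : Len m T u2 v2 a b ≤ wDist m (Gr T u2 a) (Gr T u2 b))
    {x : ℝ × ℝ} (hxI : x.2 ∈ Icc a b) (hx : T (u2 x.2) < x.1 ∧ x.1 < T (u1 x.2))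
    (hC : ∀ C : Set (ℝ × ℝ), IsPreconnected C → x ∈ C →
      (∀ z ∈ C, z.2 ∈ Icc a b → z.1 ≠ T (u1 z.2) ∧ z.1 ≠ T (u2 z.2)) → ∀ z ∈ C, z.1 < 0)
    {σ : ℝ → ℝ × ℝ} (hσ : IsUnitGeodesic m σ) (hσ0 : σ 0 = Gr T u1 a) {L : ℝ} (hL : 0 < L)
    (hσL : σ L = x) (hσmin : IsMinimalSeg m σ L) (hcut : ∀ ε > 0, ¬ IsMinimalSeg m σ (L + ε)) :
    False := by
  have hxx := hx.1.trans hx.2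
  have hxI : x.2 ∈ Ioo a b := by
    refine ⟨lt_of_le_of_ne hxI.1 fun e => ?_, lt_of_le_of_ne hxI.2 fun e => ?_⟩
    · rw [← e, ha] at hxx; exact lt_irrefl _ hxx
    · rw [e, hb] at hxx; exact lt_irrefl _ hxx
  have c1 := h1.cur o1
  have c2 := h2.cur o2
  have hG := fun u hu => GG_deriv h hm (u := u) hu
  have hg := g_cont h hm
  have UTlt : ∀ u ∈ J, ∀ t, T u < t ↔ u < U t := fun u hu t => by
    rw [← h.Umono.lt_iff_lt, h.UT u hu]
  have UTgt : ∀ u ∈ J, ∀ t, t < T u ↔ U t < u := fun u hu t => by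
    rw [← h.Umono.lt_iff_lt, h.UT u hu]
  have hxs := Ioo_subset_Icc_self hxI
  have X2 : u2 x.2 < U x.1 := (UTlt _ (h2 _ (s2 hxs)).1 _).1 hx.1
  have X1 : U x.1 < u1 x.2 := (UTgt _ (h1 _ (s1 hxs)).1 _).1 hx.2
  have hne : ∀ z ∈ Ioo a b, u1 z ≠ u2 z := by
    intro z hz e
    have hv := meet h h1 o1 c2 h2 o2 hz.1 hz.2 ((Icc_subset_Icc_right hz.2.le).trans s1) s2
      ((Icc_subset_Icc_left hz.1.le).trans s2) ha e
      (c1.min_sub h hz.1.le hz.2.le s1 m1) m2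
    have hzs := Ioo_subset_Icc_self hz
    have := (sol_unique h hG hg (r1.inter r2) (fun s hs => h1 s hs.1) (fun s hs => h2 s hs.2)
      ⟨s1 hzs, s2 hzs⟩ e hv ⟨s1 hxs, s2 hxs⟩).1
    linarith
  have cu1 := c1.ucont.mono s1
  have cu2 := c2.ucont.mono s2
  have hlt : ∀ z ∈ Ioo a b, u2 z < u1 z := by
    intro z hz
    by_contra hn
    push Not at hn
    have hc : ContinuousOn (fun s => u1 s - u2 s) (Ioo a b) :=
      (cu1.sub cu2).mono Ioo_subset_Icc_self
    obtain ⟨r, hr, he⟩ := isPreconnected_Ioo.intermediate_value hz hxI hc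
      (show (0:ℝ) ∈ Icc _ _ from ⟨by linarith, by linarith⟩)
    exact hne r hr (sub_eq_zero.1 he)
  have cT1 : ContinuousOn (fun s => T (u1 s)) (Icc a b) := (Tcont h).comp cu1 (fun s hs => (h1 s (s1 hs)).1)
  have cT2 : ContinuousOn (fun s => T (u2 s)) (Icc a b) := (Tcont h).comp cu2 (fun s hs => (h2 s (s2 hs)).1)
  have hneg0 := topo2 cT1 cT2 hxI hx (fun τ hτ => by
    have hτ' := Ioo_subset_Icc_self hτ
    rw [UTlt _ (h2 _ (s2 hτ')).1, h.UT _ (h1 _ (s1 hτ')).1]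
    exact hlt τ hτ) hC
  have hneg1 : MapsTo u1 (Ioo a b) (Iic 0) := fun τ hτ => by
    have := h.Umono.monotone (hneg0 τ hτ)
    rwa [hU0, h.UT _ (h1 _ (s1 (Ioo_subset_Icc_self hτ))).1] at this
  have hneg : ∀ s ∈ Icc a b, u1 s ≤ 0 := by
    have := hneg1.closure_of_continuousOn (by rw [closure_Ioo hab.ne]; exact cu1)
    rw [closure_Ioo hab.ne, closure_Iic] at this
    exact this
  have eA : Gr T u2 a = Gr T u1 a := by simp [Gr, ha]
  have eB : Gr T u2 b = Gr T u1 b := by simp [Gr, hb]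
  have hlen : Len m T u1 v1 a b = Len m T u2 v2 a b := by
    have q1 := c1.le h hab.le s1
    have q2 := c2.le h hab.le s2
    rw [eA, eB] at m2 q2
    linarith
  have hden : 0 < u1 x.2 - u2 x.2 := by linarith
  set l := (u1 x.2 - U x.1) / (u1 x.2 - u2 x.2) with hl
  have hl01 : l ∈ Ioo (0:ℝ) 1 := ⟨div_pos (by linarith) hden, by rw [hl, div_lt_one hden]; linarith⟩
  obtain ⟨cl, sl, ll⟩ := conv_core h (GG_concave h hU0 hm hmeven hKdec) (o1.inter o2)
    (fun s hs => h1 s hs.1) (fun s hs => h2 s hs.2) hab (fun s hs => ⟨s1 hs, s2 hs⟩) ha hb hlt hneg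
    hlen hl01
  have ua : u1 a + l * (u2 a - u1 a) = u1 a := by rw [ha]; ring
  have ub : u1 b + l * (u2 b - u1 b) = u1 b := by rw [hb]; ring
  have ux : u1 x.2 + l * (u2 x.2 - u1 x.2) = U x.1 := by rw [hl]; field_simp; ring
  set w : ℝ → ℝ := fun s => u1 s + l * (u2 s - u1 s) with hw
  set wv : ℝ → ℝ := fun s => v1 s + l * (v2 s - v1 s) with hwv
  have wa : w a = u1 a := ua
  have wb : w b = u1 b := ub
  have wx : w x.2 = U x.1 := ux
  have s12 : Icc a b ⊆ I1 ∩ I2 := fun s hs => ⟨s1 hs, s2 hs⟩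
  have lm : Len m T w wv a b ≤ wDist m (Gr T w a) (Gr T w b) := by
    rw [show Gr T w a = Gr T u1 a by simp [Gr, wa], show Gr T w b = Gr T u1 b by simp [Gr, wb], ll]
    exact m1
  have σ02 : (σ 0).2 = a := by rw [hσ0]; rfl
  have σ01 : (σ 0).1 = T (u1 a) := by rw [hσ0]; rfl
  obtain ⟨us, vs, Is, os, rs, hs, mono, hIs, grs, us1, lens⟩ := geo_graph h hσ hL
    (by rw [σ02, hσL]; exact hxI.1)
  have cs := hs.cur os
  have usa : us a = u1 a := by
    have := us1 0
    rwa [σ02, σ01, h.UT _ (h1 _ (s1 ⟨le_rfl, hab.le⟩)).1] at this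
  have usx : us x.2 = U x.1 := by have := us1 L; rwa [hσL] at this
  have gsa : Gr T us a = σ 0 := by rw [← σ02]; exact grs 0
  have gsx : Gr T us x.2 = x := by have := grs L; rwa [hσL] at this
  have lsx : Len m T us vs a x.2 = L := by have := lens 0 L; rwa [σ02, hσL, sub_zero] at this
  have aIs : a ∈ Is := by rw [hIs]; exact ⟨0, σ02⟩
  have xIs : x.2 ∈ Is := by rw [hIs]; exact ⟨L, by simp only [hσL]⟩
  have ssub : Icc a x.2 ⊆ Is := rs.out aIs xIs
  have hmin : wDist m (σ 0) x = L := by have : wDist m (σ 0) (σ L) = L := hσmin; rwa [hσL] at this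
  -- match derivatives at x
  obtain ⟨b', hb1, hb2⟩ := exists_between hxI.2
  have hv : vs x.2 = wv x.2 := by
    refine meet h hs os cl sl isOpen_Ioo hxI.1 hb1 ssub
      ((Icc_subset_Icc_right hb2.le).trans s12) (fun r hr => ⟨hxI.1.trans_le hr.1, hr.2.trans_lt hb2⟩)
      (by rw [usa, wa]) (by rw [usx, wx]) ?_ (cl.min_sub h (hxI.1.trans hb1).le hb2.le s12 lm)
    rw [gsa, gsx, lsx, hmin]
  have huniq : ∀ r ∈ Is ∩ Ioo a b, us r = w r ∧ vs r = wv r := fun r hr =>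
    sol_unique h hG hg (rs.inter ordConnected_Ioo) (fun s hs' => hs s hs'.1) (fun s hs' => sl s hs'.2)
      ⟨xIs, hxI⟩ (by rw [usx, wx]) hv hr
  -- extend
  have hcont : Continuous (fun s => (σ s).2) := hσ.1.continuous.snd
  have hev : ∀ᶠ r in 𝓝 L, (σ r).2 < b := by
    have := hcont.tendsto L
    rw [hσL] at this
    exact this (Iio_mem_nhds hxI.2)
  obtain ⟨δ, hδ, hδb⟩ := Metric.eventually_nhds_iff.1 hev
  have hε : 0 < δ / 2 := by linarith
  set ε := δ / 2 with hεd
  apply hcut ε hε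
  have dlt : (σ (L + ε)).2 < b := hδb (by simp [Real.dist_eq, abs_of_pos hε]; linarith)
  have dgt : x.2 < (σ (L + ε)).2 := by
    have : (σ L).2 < (σ (L + ε)).2 := mono (by linarith)
    rwa [hσL] at this
  set d := (σ (L + ε)).2 with hd
  have dIs : d ∈ Is := by rw [hIs]; exact ⟨L + ε, rfl⟩
  have hlend : Len m T us vs a d = L + ε := by have := lens 0 (L + ε); rwa [σ02, sub_zero] at this
  have hlenxd : Len m T us vs x.2 d = ε := by
    have := lens L (L + ε); rw [hσL] at this; rw [this]; ring
  have grd : Gr T us d = σ (L + ε) := grs _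
  change wDist m (σ 0) (σ (L + ε)) = L + ε
  apply le_antisymm
  · rw [← gsa, ← grd, ← hlend]
    exact cs.le h (hxI.1.trans dgt).le (rs.out aIs dIs)
  · have e1 := cl.min_sub h (hxI.1.trans dgt).le dlt.le s12 lm
    have e2 := cl.add h hxI.1.le dgt.le ((Icc_subset_Icc_right dlt.le).trans s12)
    have e3 := cl.le h hxI.1.le ((Icc_subset_Icc_right hxI.2.le).trans s12)
    have gwx : Gr T w x.2 = x := by rw [← gsx]; simp [Gr, wx, usx]
    have gwa : Gr T w a = σ 0 := by rw [← gsa]; simp [Gr, wa, usa]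
    have gwd : Gr T w d = σ (L + ε) := by
      rw [← grd]; simp [Gr, (huniq d ⟨dIs, hxI.1.trans dgt, dlt⟩).1]
    have e4 : Len m T w wv x.2 d = ε := by
      rw [← hlenxd]
      unfold Len
      refine intervalIntegral.integral_congr fun r hr => ?_
      rw [uIcc_of_le dgt.le] at hr
      have := huniq r ⟨rs.out xIs dIs hr, hxI.1.trans_le hr.1, hr.2.trans_lt dlt⟩
      simp only [this.1, this.2]
    rw [gwx, gwa, hmin] at e3
    rw [gwa, gwd] at e1
    linarith

lemma core (hm : ContDiff ℝ (⊤:ℕ∞) m) (hmpos : ∀ t, 0 < m t)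
    (hmeven : ∀ t, m (-t) = m t) (hKdec : AntitoneOn (gaussK m) (Ici 0))
    {p y x : ℝ × ℝ} (hpy : p.2 < y.2)
    {α β σ : ℝ → ℝ × ℝ} {Lα Lβ L : ℝ} (hLα : 0 < Lα) (hLβ : 0 < Lβ) (hL : 0 < L)
    (hα : IsUnitGeodesic m α) (hβ : IsUnitGeodesic m β) (hσ : IsUnitGeodesic m σ)
    (hα0 : α 0 = p) (hβ0 : β 0 = p) (hσ0 : σ 0 = p) (hαL : α Lα = y) (hβL : β Lβ = y)
    (hσL : σ L = x)
    (hαmin : IsMinimalSeg m α Lα) (hβmin : IsMinimalSeg m β Lβ) (hσmin : IsMinimalSeg m σ L)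
    (hcut : ∀ ε > 0, ¬ IsMinimalSeg m σ (L + ε))
    (hx : x ∉ α '' Icc 0 Lα ∪ β '' Icc 0 Lβ)
    (hC : ∀ C : Set (ℝ × ℝ), IsPreconnected C → x ∈ C → C ⊆ (α '' Icc 0 Lα ∪ β '' Icc 0 Lβ)ᶜ →
      ∀ z ∈ C, z.1 < 0) : False := by
  obtain ⟨U, T, J, h, hU0⟩ := exists_WData hm hmpos
  have key : ∀ (γ : ℝ → ℝ × ℝ) (l : ℝ), 0 < l → IsUnitGeodesic m γ → γ 0 = p → γ l = y →
      IsMinimalSeg m γ l → ∃ (u v : ℝ → ℝ) (I : Set ℝ), IsOpen I ∧ OrdConnected I ∧ Sol m T J u v I ∧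
        Icc p.2 y.2 ⊆ I ∧ u p.2 = U p.1 ∧ u y.2 = U y.1 ∧ Gr T u p.2 = p ∧ 
        Len m T u v p.2 y.2 ≤ wDist m (Gr T u p.2) (Gr T u y.2) ∧
        ∀ z, z ∈ γ '' Icc 0 l ↔ (z.2 ∈ Icc p.2 y.2 ∧ z.1 = T (u z.2)) := by
    intro γ l hl hγ h0 h1 hmin
    obtain ⟨u, v, I, oI, rI, hsol, mono, hI, gr, hu, hlen⟩ := geo_graph h hγ hl (by rw [h0, h1]; exact hpy)
    have gp : Gr T u p.2 = p := by have := gr 0; rwa [h0] at this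
    have gy : Gr T u y.2 = y := by have := gr l; rwa [h1] at this
    have sub : Icc p.2 y.2 ⊆ I := rI.out (by rw [hI]; exact ⟨0, by simp [h0]⟩)
      (by rw [hI]; exact ⟨l, by simp [h1]⟩)
    refine ⟨u, v, I, oI, rI, hsol, sub, ?_, ?_, gp, ?_, fun z => ⟨?_, ?_⟩⟩
    · have := hu 0; rwa [h0] at this
    · have := hu l; rwa [h1] at this
    · have e := hlen 0 l
      have e2 : wDist m (γ 0) (γ l) = l := hmin
      rw [h0, h1] at e e2
      rw [gp, gy, e, e2, sub_zero]
    · rintro ⟨s, hs, rfl⟩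
      refine ⟨⟨?_, ?_⟩, ?_⟩
      · rw [← h0]; exact mono.monotone hs.1
      · rw [← h1]; exact mono.monotone hs.2
      · exact (congrArg Prod.fst (gr s)).symm
    · rintro ⟨hz, hz1⟩
      have := sub hz
      rw [hI] at this
      obtain ⟨s, hs⟩ := this
      simp only at hs
      refine ⟨s, ⟨?_, ?_⟩, ?_⟩
      · rw [← mono.le_iff_le]; simp only [h0, hs]; exact hz.1
      · rw [← mono.le_iff_le]; simp only [h1, hs]; exact hz.2
      · rw [← gr s, hs]; exact Prod.ext hz1.symm rfl
  obtain ⟨u1, v1, I1, o1, r1, h1, s1, p1, y1, g1, m1, i1⟩ := key α Lα hLα hα hα0 hαL hαmin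
  obtain ⟨u2, v2, I2, o2, r2, h2, s2, p2, y2, g2, m2, i2⟩ := key β Lβ hLβ hβ hβ0 hβL hβmin
  have cT1 : ContinuousOn (fun s => T (u1 s)) (Icc p.2 y.2) :=
    (Tcont h).comp ((h1.cur o1).ucont.mono s1) (fun s hs => (h1 s (s1 hs)).1)
  have cT2 : ContinuousOn (fun s => T (u2 s)) (Icc p.2 y.2) :=
    (Tcont h).comp ((h2.cur o2).ucont.mono s2) (fun s hs => (h2 s (s2 hs)).1)
  have hC1 : ∀ C : Set (ℝ × ℝ), IsPreconnected C → x ∈ C →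
      (∀ z ∈ C, z.2 ∈ Icc p.2 y.2 → z.1 ≠ T (u1 z.2) ∧ z.1 ≠ T (u2 z.2)) → ∀ z ∈ C, z.1 < 0 := by
    intro C hP hxC hz
    refine hC C hP hxC fun z hzC => ?_
    rw [mem_compl_iff, mem_union, i1, i2]
    rintro (⟨k1, k2⟩ | ⟨k1, k2⟩)
    · exact (hz z hzC k1).1 k2
    · exact (hz z hzC k1).2 k2
  have hC2 : ∀ C : Set (ℝ × ℝ), IsPreconnected C → x ∈ C →
      (∀ z ∈ C, z.2 ∈ Icc p.2 y.2 → z.1 ≠ T (u2 z.2) ∧ z.1 ≠ T (u1 z.2)) → ∀ z ∈ C, z.1 < 0 :=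
    fun C hP hxC hz => hC1 C hP hxC fun z k1 k2 => (hz z k1 k2).symm
  rw [mem_union, i1, i2] at hx
  push Not at hx
  obtain ⟨hxI, hb | hb⟩ := topo1 cT1 cT2 (fun k => ⟨hx.1 k, hx.2 k⟩) hC1
  · exact core_ordered h hU0 hm hmeven hKdec o2 o1 r2 r1 h2 h1 hpy s2 s1 (p2.trans p1.symm)
      (y2.trans y1.symm) m2 m1 hxI hb hC2 hσ (by rw [hσ0, g2]) hL hσL hσmin hcut
  · exact core_ordered h hU0 hm hmeven hKdec o1 o2 r1 r2 h1 h2 hpy s1 s2 (p1.trans p2.symm)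
      (y1.trans y2.symm) m1 m2 hxI hb hC1 hσ (by rw [hσ0, g1]) hL hσL hσmin hcut

end

open Real Set
noncomputable section

open Filter Topology MeasureTheory
open scoped Interval NNReal

variable {m : ℝ → ℝ}

def Rf (p : ℝ × ℝ) : ℝ × ℝ := (p.1, -p.2)

lemma Rf_Rf (p : ℝ × ℝ) : Rf (Rf p) = p := by simp [Rf]

lemma Rf_cont : Continuous Rf := by unfold Rf; fun_prop

lemma deriv_Rf (c : ℝ → ℝ × ℝ) (s : ℝ) :
    deriv (fun u => (Rf (c u)).2) s = - deriv (fun u => (c u).2) s := by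
  simp only [Rf]
  exact deriv.fun_neg

lemma wLength_Rf (c : ℝ → ℝ × ℝ) (a b : ℝ) : wLength m (fun s => Rf (c s)) a b = wLength m c a b := by
  unfold wLength
  simp only [deriv_Rf, neg_sq]
  rfl

lemma wDist_Rf_le (p q : ℝ × ℝ) : wDist m (Rf p) (Rf q) ≤ wDist m p q := by
  refine le_of_forall_pos_le_add fun ε hε => ?_
  obtain ⟨c, b, hb, hc, h0, h1, hL⟩ := wDist_exists m p q hε
  have hc' : ContDiff ℝ 1 (fun s => Rf (c s)) := hc.fst.prodMk hc.snd.neg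
  have := wDist_le m _ hc' hb (p := Rf p) (q := Rf q) (by rw [h0]) (by rw [h1])
  rw [wLength_Rf] at this
  linarith

lemma wDist_Rf (p q : ℝ × ℝ) : wDist m (Rf p) (Rf q) = wDist m p q := by
  apply le_antisymm (wDist_Rf_le p q)
  have := wDist_Rf_le (m := m) (Rf p) (Rf q)
  rwa [Rf_Rf, Rf_Rf] at this

lemma geo_Rf {γ : ℝ → ℝ × ℝ} (h : IsUnitGeodesic m γ) : IsUnitGeodesic m (fun s => Rf (γ s)) := by
  obtain ⟨h1, h2, ⟨ν, h3⟩, h4⟩ := h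
  refine ⟨h1.fst.prodMk h1.snd.neg, fun s => ?_, ⟨-ν, fun s => ?_⟩, fun s => ?_⟩
  · rw [deriv_Rf, neg_sq]; exact h2 s
  · rw [deriv_Rf, ← h3 s]; simp only [Rf]; ring
  · rw [deriv_Rf, neg_sq]; exact h4 s

lemma min_Rf {γ : ℝ → ℝ × ℝ} {a : ℝ} : IsMinimalSeg m (fun s => Rf (γ s)) a ↔ IsMinimalSeg m γ a := by
  unfold IsMinimalSeg
  rw [wDist_Rf]

lemma meridian (hmpos : ∀ t, 0 < m t) {γ : ℝ → ℝ × ℝ} (h : IsUnitGeodesic m γ) {L : ℝ} (hL : 0 < L)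
    {p y : ℝ × ℝ} (h0 : γ 0 = p) (h1 : γ L = y) (he : p.2 = y.2) :
    γ '' Icc 0 L = (fun t => (t, p.2)) '' uIcc p.1 y.1 := by
  obtain ⟨d1, d2, d3⟩ := geo_derivs h
  obtain ⟨-, -, ⟨ν, hν⟩, hunit⟩ := h
  have hz : ∀ s, deriv (fun u => (γ u).2) s = 0 := by
    obtain ⟨c, -, hc⟩ := exists_deriv_eq_zero (f := fun u => (γ u).2) hL
      (fun s _ => (d2 s).continuousAt.continuousWithinAt) (by simp only [h0, h1, he])
    have : ν = 0 := by rw [← hν c, hc, mul_zero]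
    intro s
    have h3 := hν s
    rw [this] at h3
    exact (mul_eq_zero.1 h3).resolve_left (pow_pos (hmpos _) 2).ne'
  have c2 : ∀ s, (γ s).2 = p.2 := fun s => by
    rw [← h0]
    exact is_const_of_deriv_eq_zero (fun s => (d2 s).differentiableAt) hz s 0
  simp only [hz] at d3 hunit
  set c := deriv (fun u => (γ u).1) 0 with hc
  have c1 : ∀ s, deriv (fun u => (γ u).1) s = c := fun s =>
    is_const_of_deriv_eq_zero (fun s => (d3 s).differentiableAt) (fun s => by rw [(d3 s).deriv]; ring) s 0
  have ht : ∀ s, (γ s).1 = p.1 + c * s := by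
    have dd : ∀ s, HasDerivAt (fun u => (γ u).1 - c * u) 0 s := fun s => by
      have := (d1 s).sub ((hasDerivAt_id s).const_mul c)
      rw [c1] at this
      exact this.congr_deriv (by simp)
    intro s
    have := is_const_of_deriv_eq_zero (fun s => (dd s).differentiableAt) (fun s => (dd s).deriv) s 0
    simp only [h0, mul_zero, sub_zero] at this
    linarith
  have hy1 : y.1 = p.1 + c * L := by rw [← ht, h1]
  have hcsq : c ^ 2 = 1 := by have := hunit 0; simpa using this
  have hcc : c = 1 ∨ c = -1 := by
    have : (c - 1) * (c + 1) = 0 := by linarith [hcsq, show (c - 1) * (c + 1) = c ^ 2 - 1 by ring]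
    rcases mul_eq_zero.1 this with e | e
    · left; linarith
    · right; linarith
  ext z
  constructor
  · rintro ⟨s, hs, rfl⟩
    refine ⟨(γ s).1, ?_, Prod.ext rfl (c2 s).symm⟩
    rw [ht, hy1, mem_uIcc]
    rcases hcc with e | e <;> rw [e]
    · left; constructor <;> linarith [hs.1, hs.2]
    · right; constructor <;> linarith [hs.1, hs.2]
  · rintro ⟨t, htt, rfl⟩
    rw [hy1, mem_uIcc] at htt
    refine ⟨c * (t - p.1), ?_, Prod.ext ?_ (c2 _)⟩
    · rcases hcc with e | e <;> rw [e] at htt ⊢ <;> rcases htt with q | q <;>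
        constructor <;> linarith [q.1, q.2]
    · rw [ht]
      simp only
      linear_combination (t - p.1) * hcsq

lemma vacuous (hm : ContDiff ℝ (⊤:ℕ∞) m) (hmpos : ∀ t, 0 < m t)
    (hmeven : ∀ t, m (-t) = m t) (hKdec : AntitoneOn (gaussK m) (Ici 0))
    {p y x : ℝ × ℝ} {α β : ℝ → ℝ × ℝ} {Lα Lβ : ℝ} (hLα : 0 < Lα) (hLβ : 0 < Lβ)
    (hα : IsUnitGeodesic m α) (hβ : IsUnitGeodesic m β)
    (hα0 : α 0 = p) (hβ0 : β 0 = p) (hαL : α Lα = y) (hβL : β Lβ = y)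
    (hαmin : IsMinimalSeg m α Lα) (hβmin : IsMinimalSeg m β Lβ)
    (hdistinct : α '' Set.Icc 0 Lα ≠ β '' Set.Icc 0 Lβ)
    {D : Set (ℝ × ℝ)} (hD : IsSectorOf α β Lα Lβ D)
    (hDneg : D ⊆ {z : ℝ × ℝ | z.1 < 0}) (hx : IsCutPoint m p x) (hxD : x ∈ D) : False := by
  obtain ⟨σ, L, hσ, hσ0, hL, hσL, hσmin, hcut⟩ := hx
  obtain ⟨z, hz, rfl⟩ := hD
  have hxn := connectedComponentIn_subset _ _ hxD
  have hC : ∀ C : Set (ℝ × ℝ), IsPreconnected C → x ∈ C → C ⊆ (α '' Icc 0 Lα ∪ β '' Icc 0 Lβ)ᶜ →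
      ∀ z ∈ C, z.1 < 0 := by
    intro C hP hxC hsub w hw
    rw [connectedComponentIn_eq hxD] at hDneg
    exact hDneg (hP.subset_connectedComponentIn hxC hsub hw)
  rcases lt_trichotomy p.2 y.2 with hlt | heq | hgt
  · exact core hm hmpos hmeven hKdec hlt hLα hLβ hL hα hβ hσ hα0 hβ0 hσ0 hαL hβL hσL hαmin hβmin hσmin
      hcut hxn hC
  · exact hdistinct ((meridian hmpos hα hLα hα0 hαL heq).trans (meridian hmpos hβ hLβ hβ0 hβL heq).symm)
  · have him : ∀ w, w ∈ (fun s => Rf (α s)) '' Icc 0 Lα ∪ (fun s => Rf (β s)) '' Icc 0 Lβ ↔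
        Rf w ∈ α '' Icc 0 Lα ∪ β '' Icc 0 Lβ := by
      have : ∀ (γ : ℝ → ℝ × ℝ) (l : ℝ) (w : ℝ × ℝ), w ∈ (fun s => Rf (γ s)) '' Icc 0 l ↔
          Rf w ∈ γ '' Icc 0 l := by
        intro γ l w
        constructor
        · rintro ⟨s, hs, rfl⟩; exact ⟨s, hs, (Rf_Rf _).symm⟩
        · rintro ⟨s, hs, e⟩; exact ⟨s, hs, by simp only [e, Rf_Rf]⟩
      intro w
      rw [mem_union, mem_union, this, this]
    refine core (p := Rf p) (y := Rf y) (x := Rf x) hm hmpos hmeven hKdec (by simpa [Rf] using hgt)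
      hLα hLβ hL (geo_Rf hα) (geo_Rf hβ) (geo_Rf hσ)
      (by simp only [hα0]) (by simp only [hβ0]) (by simp only [hσ0]) (by simp only [hαL])
      (by simp only [hβL]) (by simp only [hσL]) (min_Rf.2 hαmin) (min_Rf.2 hβmin) (min_Rf.2 hσmin)
      (fun ε hε hh => hcut ε hε (min_Rf.1 hh)) ?_ ?_
    · rw [him, Rf_Rf]; exact hxn
    · intro C hP hxC hsub w hw
      have := hC (Rf '' C) (hP.image _ Rf_cont.continuousOn) ⟨_, hxC, Rf_Rf x⟩ (by
        rintro _ ⟨q, hq, rfl⟩ hmem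
        exact hsub hq ((him q).2 hmem)) (Rf w) ⟨w, hw, rfl⟩
      exact this

end

/-- Lemma 4.2: let `α`, `β` be distinct minimal geodesic segments from `p̃`
(`t(p̃) ≤ 0`) to a common cut point `y`, bounding a sector `D ⊆ {t < 0}` containing an end
point of the cut locus.  Then every unit-speed minimal geodesic segment `γ|[0,a]` from `p̃`
to an end point `x ∈ D` of the cut locus has `x` conjugate to `p̃` along `γ` and is shorter
than `α` and `β` (whose lengths are equal). -/
theorem stmt8 (m : ℝ → ℝ) (hm : ContDiff ℝ (⊤:ℕ∞) m) (hmpos : ∀ t, 0 < m t)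
    (hmeven : ∀ t, m (-t) = m t)
    (hK0 : 0 < gaussK m 0) (hKdec : AntitoneOn (gaussK m) (Ici 0))
    (p y : ℝ × ℝ) (hp : p.1 ≤ 0) (hy : IsCutPoint m p y)
    (α β : ℝ → ℝ × ℝ) (Lα Lβ : ℝ) (hLα : 0 < Lα) (hLβ : 0 < Lβ)
    (hα : IsUnitGeodesic m α) (hβ : IsUnitGeodesic m β)
    (hα0 : α 0 = p) (hβ0 : β 0 = p) (hαL : α Lα = y) (hβL : β Lβ = y)
    (hαmin : IsMinimalSeg m α Lα) (hβmin : IsMinimalSeg m β Lβ)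
    (hdistinct : α '' Set.Icc 0 Lα ≠ β '' Set.Icc 0 Lβ)
    (D : Set (ℝ × ℝ)) (hD : IsSectorOf α β Lα Lβ D)
    (hDneg : D ⊆ {z : ℝ × ℝ | z.1 < 0})
    (hDend : ∃ x ∈ D, IsEndPoint m p x)
    (γ : ℝ → ℝ × ℝ) (a : ℝ) (x : ℝ × ℝ) (ha : 0 < a)
    (hγ : IsUnitGeodesic m γ) (hγ0 : γ 0 = p) (hγa : γ a = x)
    (hγmin : IsMinimalSeg m γ a)
    (hx : IsEndPoint m p x) (hxD : x ∈ D) :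
    ConjugateAlong m γ a ∧ a < Lα ∧ Lα = Lβ := by
  exact (vacuous hm hmpos hmeven hKdec hLα hLβ hα hβ hα0 hβ0 hαL hβL hαmin hβmin hdistinct hD hDneg
    hx.1 hxD).elim
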